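/- arXiv:1801.09537 — 3 statements merged into one kernel-verified Lean document; each statement's English description precedes it below -/
import Mathlib

section
/- Let a < b be extended reals and let f : S_{a,b} → ℂ be positive definite on the horizontal strip S_{a,b}. If f is holomorphic on some open set Ω containing the segment Γ = {iy : a < y < b} of the imaginary axis, then f is holomorphic on all of S_{a,b} and there exists a unique nonnegative Borel measure μ on ℝ, exponentially finite with respect to (a,b), such that f(z) = ∫ℝ e^{izt} dμ(t) for all z ∈ S_{a,b}. -/
open Complex MeasureTheory Filter Set Topology
open scoped Real BigOperators ComplexOrder

noncomputable section

/-- `f : ℝ → ℂ` is positive definite. -/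
def IsPosDefFun (f : ℝ → ℂ) : Prop :=
  ∀ (n : ℕ) (x : Fin n → ℝ) (ξ : Fin n → ℂ),
    0 ≤ ∑ k, ∑ l, f (x k - x l) * ξ k * (starRingEnd ℂ) (ξ l)

/-- `f` is positive definite on `S ⊆ ℂ`. -/
def IsPosDefOnC (f : ℂ → ℂ) (S : Set ℂ) : Prop :=
  ∀ (n : ℕ) (z : Fin n → ℂ), (∀ k l, z k - (starRingEnd ℂ) (z l) ∈ S) →
    ∀ ξ : Fin n → ℂ,
      0 ≤ ∑ k, ∑ l, f (z k - (starRingEnd ℂ) (z l)) * ξ k * (starRingEnd ℂ) (ξ l)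

/-- `f` is co-positive definite on `T ⊆ ℂ`. -/
def IsCoPosDefOnC (f : ℂ → ℂ) (T : Set ℂ) : Prop :=
  ∀ (n : ℕ) (z : Fin n → ℂ), (∀ k l, z k + (starRingEnd ℂ) (z l) ∈ T) →
    ∀ ξ : Fin n → ℂ,
      0 ≤ ∑ k, ∑ l, f (z k + (starRingEnd ℂ) (z l)) * ξ k * (starRingEnd ℂ) (ξ l)

/-- `G : ℝ → ℂ` is co-positive definite on `I ⊆ ℝ`. -/
def IsCoPosDefOnR (G : ℝ → ℂ) (I : Set ℝ) : Prop :=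
  ∀ (n : ℕ) (x : Fin n → ℝ), (∀ k l, x k + x l ∈ I) →
    ∀ ξ : Fin n → ℂ,
      0 ≤ ∑ k, ∑ l, G (x k + x l) * ξ k * (starRingEnd ℂ) (ξ l)

/-- Horizontal strip `S_{a,b}`. -/
def HStrip (a b : EReal) : Set ℂ := {z | a < (z.im : EReal) ∧ (z.im : EReal) < b}

/-- Vertical strip `T_{a,b}`. -/
def VStrip (a b : EReal) : Set ℂ := {z | a < (z.re : EReal) ∧ (z.re : EReal) < b}

/-- `μ` is exponentially finite with respect to the interval `(a,b)`. -/
def ExpFinite (μ : Measure ℝ) (a b : EReal) : Prop :=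
  ∀ y : ℝ, a < (y : EReal) → (y : EReal) < b →
    Integrable (fun t : ℝ => Real.exp (-y * t)) μ

lemma pd_zero {g : ℝ → ℂ} (hg : IsPosDefFun g) : 0 ≤ g 0 := by
  have := hg 1 (fun _ => 0) (fun _ => 1)
  simpa using this

lemma pd_neg {g : ℝ → ℂ} (hg : IsPosDefFun g) (x : ℝ) : g (-x) = (starRingEnd ℂ) (g x) := by
  have h0 := (Complex.nonneg_iff.1 (pd_zero hg)).2
  have h1 := (Complex.nonneg_iff.1 (hg 2 ![x, 0] ![1, 1])).2
  have h2 := (Complex.nonneg_iff.1 (hg 2 ![x, 0] ![1, I])).2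
  simp [Fin.sum_univ_two] at h1 h2 h0
  apply Complex.ext
  · simp; linarith
  · simp; linarith

lemma pd_two {g : ℝ → ℂ} (hg : IsPosDefFun g) (h0 : g 0 = 0) (x : ℝ) : g x = 0 := by
  have h1 := (Complex.nonneg_iff.1 (hg 2 ![x, 0] ![-(starRingEnd ℂ) (g x), 1])).1
  simp [Fin.sum_univ_two, h0, pd_neg hg] at h1
  apply Complex.ext
  · simp; nlinarith
  · simp; nlinarith

lemma pd_krein {g : ℝ → ℂ} (hg : IsPosDefFun g) (h0 : g 0 = 1) (x y : ℝ) :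
    ‖g x - g y‖ ^ 2 ≤ 2 * (1 - (g (x - y)).re) := by
  have h1 := (Complex.nonneg_iff.1 (hg 3 ![x, y, 0] ![1, -1, -(g x - g y)])).1
  have h2 : g (y - x) = (starRingEnd ℂ) (g (x - y)) := by rw [← pd_neg hg]; congr 1; ring
  simp [Fin.sum_univ_three, h0, pd_neg hg, h2] at h1
  rw [← Complex.normSq_eq_norm_sq, Complex.normSq_apply]
  simp
  nlinarith

lemma pd_continuous {g : ℝ → ℂ} (hg : IsPosDefFun g) (h0 : g 0 = 1) (hc : ContinuousAt g 0) :
    Continuous g := by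
  rw [continuous_iff_continuousAt]
  intro x
  have h1 : Tendsto (fun y => 2 * (1 - (g (y - x)).re)) (𝓝 x) (𝓝 0) := by
    have e1 : Tendsto (fun y => y - x) (𝓝 x) (𝓝 0) := by
      have : Continuous (fun y : ℝ => y - x) := by fun_prop
      simpa using this.tendsto x
    have e2 : Tendsto (fun y => (g (y - x)).re) (𝓝 x) (𝓝 1) := by
      have := (Complex.continuous_re.tendsto _).comp (hc.tendsto.comp e1)
      simpa [h0, Function.comp_def] using this
    simpa using (e2.const_sub 1).const_mul 2
  have h2 : Tendsto (fun y => ‖g y - g x‖ ^ 2) (𝓝 x) (𝓝 0) :=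
    squeeze_zero (fun _ => by positivity) (fun y => pd_krein hg h0 y x) h1
  have h3 : Tendsto (fun y => ‖g y - g x‖) (𝓝 x) (𝓝 0) := by
    have := h2.sqrt
    simpa [Real.sqrt_sq] using this
  exact tendsto_iff_norm_sub_tendsto_zero.2 h3

lemma int_exp_orth (h : ℝ) (hh : 0 < h) (j : ℤ) :
    ∫ t in (-(π / h))..(π / h), Complex.exp (j * h * t * I) = if j = 0 then (2 * π / h : ℂ) else 0 := by
  split_ifs with hj
  · subst hj
    simp
    ring
  · have hc : (j * h * I : ℂ) ≠ 0 := by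
      simp [hj, hh.ne']
    have e : ∀ t : ℝ, Complex.exp (j * h * t * I) = Complex.exp ((j * h * I) * t) := by
      intro t; congr 1; ring
    simp_rw [e]
    rw [integral_exp_mul_complex hc]
    have hh' : (h : ℂ) ≠ 0 := by simp [hh.ne']
    have e1 : (j * h * I : ℂ) * ((π / h : ℝ) : ℂ) = (j * h * I : ℂ) * ((-(π / h) : ℝ) : ℂ) + j * (2 * π * I) := by
      push_cast; field_simp; ring
    rw [e1, Complex.exp_periodic.int_mul j]
    simp

/-- the Fejer density -/
def fejer (g : ℝ → ℂ) (h : ℝ) (N : ℕ) (t : ℝ) : ℂ :=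
  (h / (2 * π * N) : ℝ) * ∑ k : Fin N, ∑ l : Fin N,
    g (h * k - h * l) * Complex.exp (-(h * k * t * I)) * (starRingEnd ℂ) (Complex.exp (-(h * l * t * I)))

lemma fejer_nonneg {g : ℝ → ℂ} (hg : IsPosDefFun g) (h : ℝ) (hh : 0 < h) (N : ℕ) (t : ℝ) :
    0 ≤ fejer g h N t := by
  unfold fejer
  refine mul_nonneg ?_ (hg N (fun k => h * k) (fun k => Complex.exp (-(h * k * t * I))))
  have : 0 ≤ h / (2 * π * N) := by positivity
  exact_mod_cast this

lemma fejer_continuous (g : ℝ → ℂ) (h : ℝ) (N : ℕ) : Continuous (fejer g h N) := by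
  unfold fejer
  fun_prop

lemma card_aux (N n : ℕ) :
    (∑ k : Fin N, ∑ l : Fin N, if ((k : ℕ) : ℤ) - (l : ℕ) = n then (1 : ℂ) else 0) = ((N - n : ℕ) : ℂ) := by
  rw [Finset.sum_comm]
  have : ∀ l : Fin N, (∑ k : Fin N, if ((k : ℕ) : ℤ) - (l : ℕ) = n then (1 : ℂ) else 0)
      = if (l : ℕ) < N - n then 1 else 0 := by
    intro l
    split_ifs with hl
    · rw [Finset.sum_eq_single (⟨l + n, by omega⟩ : Fin N)]
      · simp
      · intro b _ hb
        rw [if_neg]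
        intro h
        apply hb
        ext
        simp
        omega
      · simp
    · apply Finset.sum_eq_zero
      intro k _
      rw [if_neg]
      have := k.2
      omega
  simp_rw [this]
  rw [Fin.sum_univ_eq_sum_range (fun l => if l < N - n then (1 : ℂ) else 0) N]
  rw [← Finset.sum_filter]
  have : (Finset.range N).filter (fun l => l < N - n) = Finset.range (N - n) := by
    ext; simp; omega
  rw [this]; simp

lemma fejer_integral (g : ℝ → ℂ) (h : ℝ) (hh : 0 < h) (N : ℕ) (hN : 0 < N) (n : ℕ) :
    ∫ t in (-(π / h))..(π / h), Complex.exp ((h * n : ℝ) * t * I) * fejer g h N t =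
      ((N - n : ℕ) / N : ℂ) * g (h * n) := by
  have e : ∀ t : ℝ, Complex.exp ((h * n : ℝ) * t * I) * fejer g h N t =
      (h / (2 * π * N) : ℝ) * ∑ k : Fin N, ∑ l : Fin N,
        g (h * k - h * l) * Complex.exp (((n - ((k : ℕ) - (l : ℕ)) : ℤ) : ℂ) * h * t * I) := by
    intro t
    unfold fejer
    rw [mul_left_comm]
    congr 1
    simp_rw [Finset.mul_sum]
    refine Finset.sum_congr rfl fun k _ => Finset.sum_congr rfl fun l _ => ?_
    rw [← Complex.exp_conj, mul_assoc, mul_left_comm, ← Complex.exp_add, mul_assoc, ← Complex.exp_add]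
    congr 2
    simp
    ring
  simp_rw [e]
  rw [intervalIntegral.integral_const_mul]
  rw [intervalIntegral.integral_finsetSum]
  swap
  · intro i _
    apply Continuous.intervalIntegrable
    fun_prop
  have e2 : ∀ k : Fin N, ∫ t in (-(π / h))..(π / h), ∑ l : Fin N,
        g (h * k - h * l) * Complex.exp (((n - ((k : ℕ) - (l : ℕ)) : ℤ) : ℂ) * h * t * I)
      = ∑ l : Fin N, (2 * π / h : ℂ) * g (h * n) *
        if ((k : ℕ) : ℤ) - (l : ℕ) = n then (1 : ℂ) else 0 := by
    intro k
    rw [intervalIntegral.integral_finsetSum]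
    swap
    · intro i _
      apply Continuous.intervalIntegrable
      fun_prop
    refine Finset.sum_congr rfl fun l _ => ?_
    rw [intervalIntegral.integral_const_mul, int_exp_orth h hh]
    by_cases hkl : ((k : ℕ) : ℤ) - (l : ℕ) = n
    · rw [if_pos hkl, if_pos (by omega)]
      have : h * k - h * l = h * n := by
        have : ((k : ℕ) : ℝ) - (l : ℕ) = n := by exact_mod_cast hkl
        rw [← this]; ring
      rw [this]; ring
    · rw [if_neg hkl, if_neg (by omega)]
      simp
  simp_rw [e2, ← Finset.mul_sum]
  rw [card_aux]
  have hh' : (h : ℂ) ≠ 0 := by simp [hh.ne']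
  have hN' : (N : ℂ) ≠ 0 := by simp [hN.ne']
  have hpi : (π : ℂ) ≠ 0 := by simp [Real.pi_ne_zero]
  push_cast
  field_simp

lemma approx_measure {g : ℝ → ℂ} (hg : IsPosDefFun g) (h0 : g 0 = 1) (h : ℝ) (hh : 0 < h) (N : ℕ)
    (hN : 0 < N) : ∃ ν : Measure ℝ, IsProbabilityMeasure ν ∧
      (∀ n : ℕ, charFun ν (h * n) = ((N - n : ℕ) / N : ℂ) * g (h * n)) ∧
      ∀ᵐ t ∂ν, |t| ≤ π / h := by
  have hpi : 0 < π / h := by positivity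
  let ν : Measure ℝ := (volume.restrict (Ioc (-(π / h)) (π / h))).withDensity
    (fun t => ENNReal.ofReal (fejer g h N t).re)
  have hm : Measurable (fun t => ENNReal.ofReal (fejer g h N t).re) :=
    (ENNReal.continuous_ofReal.comp (Complex.continuous_re.comp (fejer_continuous g h N))).measurable
  have hcf : ∀ n : ℕ, charFun ν (h * n) = ((N - n : ℕ) / N : ℂ) * g (h * n) := by
    intro n
    rw [charFun_apply_real, integral_withDensity_eq_integral_toReal_smul hm
      (by filter_upwards with t using ENNReal.ofReal_lt_top)]
    rw [← fejer_integral g h hh N hN n, intervalIntegral.integral_of_le (by linarith)]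
    refine integral_congr_ae ?_
    filter_upwards with t
    have hp := Complex.nonneg_iff.1 (fejer_nonneg hg h hh N t)
    rw [ENNReal.toReal_ofReal hp.1]
    have : fejer g h N t = ((fejer g h N t).re : ℂ) := by
      apply Complex.ext <;> simp [← hp.2]
    rw [Complex.real_smul, ← this, mul_comm]
  refine ⟨ν, ?_, hcf, ?_⟩
  · have h1 := hcf 0
    simp [h0, hN.ne', Measure.real] at h1
    exact ⟨by rwa [ENNReal.toReal_eq_one_iff] at h1⟩
  · refine (withDensity_absolutelyContinuous _ _).ae_le ?_
    filter_upwards [ae_restrict_mem measurableSet_Ioc] with t ht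
    rw [abs_le]; exact ⟨ht.1.le, ht.2⟩

lemma charFun_diff (ν : Measure ℝ) [IsProbabilityMeasure ν] (h : ℝ) (hh : 0 < h)
    (hν : ∀ᵐ t ∂ν, |t| ≤ π / h) (x y : ℝ) (hy : 0 ≤ x - y) (hxy : x - y ≤ h) :
    ‖charFun ν x - charFun ν y‖ ^ 2 ≤ 2 * (1 - (charFun ν h).re) := by
  have hexpi : ∀ x : ℝ, Integrable (fun t : ℝ => Complex.exp (x * t * I)) ν := by
    intro x
    refine Integrable.of_bound (by fun_prop) 1 ?_
    filter_upwards with t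
    rw [← Complex.ofReal_mul, Complex.norm_exp_ofReal_mul_I]
  set w : ℝ → ℝ := fun t => ‖Complex.exp (x * t * I) - Complex.exp (y * t * I)‖ with hw
  have hwb : ∀ t, w t ≤ 2 := by
    intro t
    refine (norm_sub_le _ _).trans ?_
    rw [← Complex.ofReal_mul, ← Complex.ofReal_mul, Complex.norm_exp_ofReal_mul_I,
      Complex.norm_exp_ofReal_mul_I]
    norm_num
  have hwc : Continuous w := by fun_prop
  have hwi : Integrable w ν := ((hexpi x).sub (hexpi y)).norm
  have hwi2 : Integrable (fun t => w t ^ 2) ν := by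
    refine Integrable.of_bound (by fun_prop) 4 ?_
    filter_upwards with t
    rw [Real.norm_of_nonneg (by positivity)]
    nlinarith [hwb t, norm_nonneg (Complex.exp (x * t * I) - Complex.exp (y * t * I))]
  have h1 : ‖charFun ν x - charFun ν y‖ ≤ ∫ t, w t ∂ν := by
    rw [charFun_apply_real, charFun_apply_real, ← integral_sub (hexpi x) (hexpi y)]
    exact norm_integral_le_integral_norm _
  have h2 : (∫ t, w t ∂ν) ^ 2 ≤ ∫ t, w t ^ 2 ∂ν := by
    set A := ∫ t, w t ∂ν with hA
    have e : ∫ t, (w t - A) ^ 2 ∂ν = ∫ t, w t ^ 2 ∂ν - A ^ 2 := by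
      have : ∀ t, (w t - A) ^ 2 = w t ^ 2 - 2 * A * w t + A ^ 2 := fun t => by ring
      simp_rw [this]
      have i1 : Integrable (fun t => w t ^ 2 - 2 * A * w t) ν := hwi2.sub (hwi.const_mul _)
      rw [integral_add i1 (integrable_const _), integral_sub hwi2 (hwi.const_mul _), integral_const_mul, ← hA]
      simp
      ring
    have : 0 ≤ ∫ t, (w t - A) ^ 2 ∂ν := integral_nonneg fun t => by positivity
    linarith
  have hre : (charFun ν h).re = ∫ t, Real.cos (h * t) ∂ν := by
    rw [charFun_apply_real]
    have := integral_re (hexpi h)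
    simp only [RCLike.re_to_complex] at this
    rw [← this]
    congr 1 with t
    rw [← Complex.ofReal_mul, Complex.exp_ofReal_mul_I_re]
  have hic : Integrable (fun t => Real.cos (h * t)) ν := by
    refine Integrable.of_bound (by fun_prop) 1 ?_
    filter_upwards with t using Real.abs_cos_le_one _
  have h3 : ∫ t, w t ^ 2 ∂ν ≤ ∫ t, 2 * (1 - Real.cos (h * t)) ∂ν := by
    refine integral_mono_ae hwi2 (((integrable_const _).sub hic).const_mul _) ?_
    filter_upwards [hν] with t ht
    have e1 : w t ^ 2 = 2 * (1 - Real.cos ((x - y) * t)) := by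
      simp only [hw]
      rw [← Complex.normSq_eq_norm_sq, Complex.normSq_apply, ← Complex.ofReal_mul,
        ← Complex.ofReal_mul]
      simp only [Complex.sub_re, Complex.sub_im, Complex.exp_ofReal_mul_I_re,
        Complex.exp_ofReal_mul_I_im]
      rw [sub_mul x y t, Real.cos_sub]
      nlinarith [Real.sin_sq_add_cos_sq (x * t), Real.sin_sq_add_cos_sq (y * t)]
    rw [e1]
    have e2 : Real.cos (h * t) ≤ Real.cos ((x - y) * t) := by
      rw [← Real.cos_abs (h * t), ← Real.cos_abs ((x - y) * t)]
      apply Real.cos_le_cos_of_nonneg_of_le_pi (abs_nonneg _)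
      · rw [abs_mul, abs_of_pos hh]
        calc h * |t| ≤ h * (π / h) := by gcongr
          _ = π := by field_simp
      · rw [abs_mul, abs_mul, abs_of_pos hh, abs_of_nonneg hy]
        gcongr
    linarith
  have h4 : ∫ t, 2 * (1 - Real.cos (h * t)) ∂ν = 2 * (1 - (charFun ν h).re) := by
    rw [integral_const_mul, integral_sub (integrable_const _) hic, hre]
    simp
  calc ‖charFun ν x - charFun ν y‖ ^ 2 ≤ (∫ t, w t ∂ν) ^ 2 := by gcongr
    _ ≤ _ := by linarith

lemma bochner_one {g : ℝ → ℂ} (hg : IsPosDefFun g) (h0 : g 0 = 1) (hc : ContinuousAt g 0) :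
    ∃ ν : Measure ℝ, IsFiniteMeasure ν ∧ ∀ x, charFun ν x = g x := by
  have hcont := pd_continuous hg h0 hc
  have H := fun m : ℕ => approx_measure hg h0 (1 / ((m : ℝ) + 1)) (by positivity) ((m + 1) ^ 2)
    (by positivity)
  choose ν hν hcf hsupp using H
  have hfin : Tendsto (fun m : ℕ => 1 / ((m : ℝ) + 1)) atTop (𝓝 0) :=
    tendsto_one_div_add_atTop_nhds_zero_nat
  -- convergence of the coefficients
  have hcoef : ∀ (x : ℝ), 0 ≤ x → ∀ n : ℕ → ℕ, (∀ m, (n m : ℝ) ≤ x * (m + 1)) →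
      Tendsto (fun m : ℕ => ((((m + 1) ^ 2 - n m : ℕ) : ℂ) / (((m + 1) ^ 2 : ℕ) : ℂ))) atTop (𝓝 1) := by
    intro x hx n hn
    have : Tendsto (fun m : ℕ => ((((m + 1) ^ 2 - n m : ℕ) : ℝ) / (((m + 1) ^ 2 : ℕ) : ℝ))) atTop (𝓝 1) := by
      refine tendsto_of_tendsto_of_tendsto_of_le_of_le (g := fun m : ℕ => 1 - x * (1 / ((m : ℝ) + 1)))
        (h := fun _ => 1) ?_ tendsto_const_nhds ?_ ?_
      · simpa using (hfin.const_mul x).const_sub 1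
      · intro m
        have hm : (0 : ℝ) < (((m + 1) ^ 2 : ℕ) : ℝ) := by positivity
        simp only
        rw [le_div_iff₀ hm]
        have e1 : (((m + 1) ^ 2 : ℕ) : ℝ) ≤ (((m + 1) ^ 2 - n m : ℕ) : ℝ) + n m := by
          exact_mod_cast (by omega : (m + 1) ^ 2 ≤ (m + 1) ^ 2 - n m + n m)
        have e2 : (1 - x * (1 / ((m : ℝ) + 1))) * (((m + 1) ^ 2 : ℕ) : ℝ)
            = (((m + 1) ^ 2 : ℕ) : ℝ) - x * (m + 1) := by
          push_cast
          field_simp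
        rw [e2]
        linarith [hn m]
      · intro m
        have hm : (0 : ℝ) < (((m + 1) ^ 2 : ℕ) : ℝ) := by positivity
        simp only
        rw [div_le_one hm]
        exact_mod_cast Nat.sub_le _ _
    have := (Complex.continuous_ofReal.tendsto 1).comp this
    simpa [Function.comp_def] using this
  have hg1 : Tendsto (fun m : ℕ => charFun (ν m) (1 / ((m : ℝ) + 1))) atTop (𝓝 1) := by
    have e : ∀ m : ℕ, charFun (ν m) (1 / ((m : ℝ) + 1)) =
        ((((m + 1) ^ 2 - 1 : ℕ) : ℂ) / (((m + 1) ^ 2 : ℕ) : ℂ)) * g (1 / ((m : ℝ) + 1)) := by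
      intro m
      simpa using hcf m 1
    simp_rw [e]
    have := (hcoef 1 zero_le_one (fun _ => 1) (fun m => by simp)).mul
      ((hcont.tendsto 0).comp hfin)
    simpa [h0, Function.comp_def] using this
  have hpos : ∀ x, 0 ≤ x → Tendsto (fun m => charFun (ν m) x) atTop (𝓝 (g x)) := by
    intro x hx
    let n : ℕ → ℕ := fun m => ⌊x * (m + 1)⌋₊
    have hn1 : ∀ m, (n m : ℝ) ≤ x * (m + 1) := fun m => Nat.floor_le (by positivity)
    have hn2 : ∀ m, x * (m + 1) < n m + 1 := fun m => Nat.lt_floor_add_one _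
    have hd1 : ∀ m : ℕ, 0 ≤ x - 1 / ((m : ℝ) + 1) * n m := by
      intro m
      have := hn1 m
      have hm : (0 : ℝ) < (m : ℝ) + 1 := by positivity
      rw [sub_nonneg, one_div_mul_eq_div, div_le_iff₀ hm]
      exact this
    have hd2 : ∀ m : ℕ, x - 1 / ((m : ℝ) + 1) * n m ≤ 1 / ((m : ℝ) + 1) := by
      intro m
      have := hn2 m
      have hm : (0 : ℝ) < (m : ℝ) + 1 := by positivity
      rw [one_div_mul_eq_div, sub_le_iff_le_add, ← add_div, le_div_iff₀ hm]
      linarith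
    have hxn : Tendsto (fun m : ℕ => 1 / ((m : ℝ) + 1) * n m) atTop (𝓝 x) := by
      have : Tendsto (fun m : ℕ => x - 1 / ((m : ℝ) + 1) * n m) atTop (𝓝 0) :=
        squeeze_zero hd1 hd2 hfin
      simpa using this.const_sub x
    have t1 : Tendsto (fun m : ℕ => charFun (ν m) (1 / ((m : ℝ) + 1) * n m)) atTop (𝓝 (g x)) := by
      simp_rw [hcf]
      have := (hcoef x hx n hn1).mul ((hcont.tendsto x).comp hxn)
      simpa [Function.comp_def] using this
    have t2 : Tendsto (fun m : ℕ => ‖charFun (ν m) x - charFun (ν m) (1 / ((m : ℝ) + 1) * n m)‖ ^ 2)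
        atTop (𝓝 0) := by
      refine squeeze_zero (g := fun m : ℕ => 2 * (1 - (charFun (ν m) (1 / ((m : ℝ) + 1))).re))
        (fun _ => by positivity) (fun m => ?_) ?_
      · have := hν m
        exact charFun_diff (ν m) _ (by positivity) (hsupp m) _ _ (hd1 m) (hd2 m)
      · have := (Complex.continuous_re.tendsto _).comp hg1
        simpa [Function.comp_def] using (this.const_sub 1).const_mul 2
    have t3 : Tendsto (fun m : ℕ => ‖charFun (ν m) x - charFun (ν m) (1 / ((m : ℝ) + 1) * n m)‖)
        atTop (𝓝 0) := by
      have := t2.sqrt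
      simpa [Real.sqrt_sq] using this
    have t4 := tendsto_zero_iff_norm_tendsto_zero.2 t3
    simpa using t4.add t1
  have hall : ∀ x, Tendsto (fun m => charFun (ν m) x) atTop (𝓝 (g x)) := by
    intro x
    rcases le_total 0 x with hx | hx
    · exact hpos x hx
    · have := (Complex.continuous_conj.tendsto _).comp (hpos (-x) (by linarith))
      rw [pd_neg hg] at this
      simpa [Function.comp_def, charFun_neg] using this
  have htight : IsTightMeasureSet (Set.range ν) := isTightMeasureSet_of_tendsto_charFun hc hall
  let P : ℕ → ProbabilityMeasure ℝ := fun m => ⟨ν m, hν m⟩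
  have hcomp : IsCompact (closure (Set.range P)) := by
    apply isCompact_closure_of_isTightMeasureSet
    convert htight using 1
    ext μ
    constructor
    · rintro ⟨_, ⟨m, rfl⟩, rfl⟩
      exact ⟨m, rfl⟩
    · rintro ⟨m, rfl⟩
      exact ⟨P m, ⟨m, rfl⟩, rfl⟩
  have hU := isCompact_iff_ultrafilter_le_nhds.1 hcomp ((hyperfilter ℕ : Ultrafilter ℕ).map P) (by
    rw [Filter.le_principal_iff]
    apply Filter.mem_of_superset _ subset_closure
    simp)
  obtain ⟨μ, -, hμ⟩ := hU
  have hT : Tendsto P (hyperfilter ℕ : Filter ℕ) (𝓝 μ) := hμ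
  refine ⟨μ, inferInstance, fun x => ?_⟩
  rw [ProbabilityMeasure.tendsto_iff_forall_integral_rclike_tendsto ℂ] at hT
  have t1 := hT (BoundedContinuousFunction.innerProbChar x)
  simp_rw [← charFun_eq_integral_innerProbChar] at t1
  have t2 : Tendsto (fun m => charFun (ν m) x) (hyperfilter ℕ : Filter ℕ) (𝓝 (g x)) :=
    (hall x).mono_left (by rw [← Nat.cofinite_eq_atTop]; exact hyperfilter_le_cofinite)
  exact tendsto_nhds_unique t1 t2

lemma bochner {g : ℝ → ℂ} (hg : IsPosDefFun g) (hc : ContinuousAt g 0) :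
    ∃ ν : Measure ℝ, IsFiniteMeasure ν ∧ ∀ x, charFun ν x = g x := by
  by_cases h0 : g 0 = 0
  · exact ⟨0, inferInstance, fun x => by simp [pd_two hg h0 x]⟩
  have hp := Complex.nonneg_iff.1 (pd_zero hg)
  have hr : g 0 = ((g 0).re : ℂ) := by apply Complex.ext <;> simp [← hp.2]
  set c : ℝ := (g 0).re with hcdef
  have hc0 : c ≠ 0 := by intro h; apply h0; rw [hr, h]; simp
  have hcpos : 0 < c := lt_of_le_of_ne hp.1 (Ne.symm hc0)
  have hc0' : (c : ℂ) ≠ 0 := by exact_mod_cast hc0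
  obtain ⟨ν, hν, hx⟩ := bochner_one (g := fun x => ((c⁻¹ : ℝ) : ℂ) * g x) (by
      intro n x ξ
      have := hg n x ξ
      have h2 : (0 : ℂ) ≤ ((c⁻¹ : ℝ) : ℂ) := by exact_mod_cast (inv_pos.2 hcpos).le
      have := mul_nonneg h2 this
      simpa [Finset.mul_sum, mul_assoc] using this)
    (by rw [hr]; push_cast; field_simp) (by fun_prop)
  refine ⟨c.toNNReal • ν, inferInstance, fun x => ?_⟩
  have : charFun (c.toNNReal • ν) x = (c : ℂ) * charFun ν x := by
    rw [charFun_apply_real, charFun_apply_real, integral_smul_nnreal_measure]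
    rw [NNReal.smul_def, Complex.real_smul, Real.coe_toNNReal _ hcpos.le]
  rw [this, hx]
  push_cast
  field_simp

lemma second_diff {H : ℂ → ℂ} (hH : AnalyticAt ℂ H 0) :
    ∃ C : ℝ, ∀ᶠ z in 𝓝 (0 : ℂ), ‖2 * H 0 - H z - H (-z)‖ ≤ C * ‖z‖ ^ 2 := by
  obtain ⟨p, hp⟩ := hH
  have h1 := hp.isBigO_sub_partialSum_pow 2
  have hneg : Tendsto (fun z : ℂ => -z) (𝓝 0) (𝓝 0) := by
    simpa using (continuous_neg (G := ℂ)).tendsto 0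
  have h2 := h1.comp_tendsto hneg
  have h0 : p.coeff 0 = H 0 := by
    have := hp.coeff_zero (fun i => 0)
    rw [FormalMultilinearSeries.apply_eq_pow_smul_coeff] at this
    simpa using this
  obtain ⟨C, hC⟩ := (h1.add (by simpa [Function.comp_def] using h2)).bound
  refine ⟨C, ?_⟩
  filter_upwards [hC] with z hz
  simp only [FormalMultilinearSeries.partialSum, Finset.sum_range_succ, Finset.sum_range_zero,
    FormalMultilinearSeries.apply_eq_pow_smul_coeff, h0] at hz
  rw [show 2 * H 0 - H z - H (-z) = -(H z - (H 0 + z * p.coeff 1) +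
    (H (-z) - (H 0 + -z * p.coeff 1))) by ring, norm_neg]
  simpa using hz

lemma iter_eq {μ : Measure ℝ} {F : ℂ → ℂ} {r : ℝ}
    (hF : AnalyticOnNhd ℂ F (Metric.ball 0 r)) (hφ : ∀ x : ℝ, |x| < r → charFun μ x = F x) (n : ℕ) :
    ∀ x : ℝ, |x| < r → iteratedDeriv n (charFun μ) x = iteratedDeriv n F x := by
  induction n with
  | zero => simpa using hφ
  | succ n ih =>
    intro x hx
    rw [iteratedDeriv_succ, iteratedDeriv_succ]
    have hx' : (x : ℂ) ∈ Metric.ball (0 : ℂ) r := by simpa using hx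
    have hd : DifferentiableAt ℂ (iteratedDeriv n F) x := by
      have := (hF.iterated_deriv n) x hx'
      rw [← iteratedDeriv_eq_iterate] at this
      exact this.differentiableAt
    have h1 := hd.hasDerivAt.comp_ofReal
    have h2 : iteratedDeriv n (charFun μ) =ᶠ[𝓝 x] fun y : ℝ => iteratedDeriv n F y := by
      have : ∀ᶠ y : ℝ in 𝓝 x, |y| < r := continuous_abs.continuousAt.eventually_lt_const hx
      filter_upwards [this] with y hy using ih y hy
    rw [h2.deriv_eq, h1.deriv]

lemma even_moment {μ : Measure ℝ} [IsFiniteMeasure μ] {F : ℂ → ℂ} {r : ℝ} (hr : 0 < r)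
    (hF : AnalyticOnNhd ℂ F (Metric.ball 0 r)) (hφ : ∀ x : ℝ, |x| < r → charFun μ x = F x) (k : ℕ) :
    MemLp (id : ℝ → ℝ) (2 * k : ℕ) μ := by
  induction k with
  | zero => simp; fun_prop
  | succ k ih =>
    have hint0 : Integrable (fun t : ℝ => t ^ (2 * k)) μ := by
      have := ih.integrable_norm_pow'
      refine this.congr ?_
      filter_upwards with t
      simp [pow_mul]
    have hintx : ∀ x : ℝ, Integrable (fun t : ℝ => (t : ℂ) ^ (2 * k) * Complex.exp (x * t * I)) μ := by
      intro x
      refine hint0.mono (by fun_prop) ?_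
      filter_upwards with t
      rw [norm_mul, ← Complex.ofReal_mul, Complex.norm_exp_ofReal_mul_I]
      simp
    set H := iteratedDeriv (2 * k) F with hHdef
    have hHan : AnalyticAt ℂ H 0 := by
      have := (hF.iterated_deriv (2 * k)) 0 (by simpa using hr)
      rwa [← iteratedDeriv_eq_iterate] at this
    have hval : ∀ x : ℝ, |x| < r → H x = I ^ (2 * k) * ∫ t : ℝ, (t : ℂ) ^ (2 * k) * Complex.exp (x * t * I) ∂μ := by
      intro x hx
      rw [hHdef, ← iter_eq hF hφ _ x hx, iteratedDeriv_charFun ih]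
    obtain ⟨C, hC⟩ := second_diff hHan
    let a : ℝ → ℝ → ℝ := fun x t => t ^ (2 * k) * (2 - 2 * Real.cos (x * t))
    have ha0 : ∀ x t, 0 ≤ a x t := by
      intro x t
      have := Real.cos_le_one (x * t)
      have h2 : 0 ≤ t ^ (2 * k) := by rw [pow_mul]; positivity
      exact mul_nonneg h2 (by linarith)
    have hai : ∀ x, Integrable (a x) μ := by
      intro x
      refine (hint0.const_mul 4).mono (by fun_prop) ?_
      filter_upwards with t
      have := Real.cos_le_one (x * t)
      have := Real.neg_one_le_cos (x * t)
      have h2 : 0 ≤ t ^ (2 * k) := by rw [pow_mul]; positivity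
      rw [Real.norm_of_nonneg (ha0 x t), Real.norm_of_nonneg (by positivity)]
      simp only [a]
      nlinarith
    have haint : ∀ x : ℝ, |x| < r → ‖2 * H 0 - H x - H (-x)‖ = ∫ t, a x t ∂μ := by
      intro x hx
      have e0 := hval 0 (by simpa using hr)
      have e1 := hval (-x) (by simpa using hx)
      simp only [ofReal_zero, ofReal_neg] at e0 e1
      have i0 : Integrable (fun t : ℝ => (t : ℂ) ^ (2 * k) * Complex.exp (0 * t * I)) μ := by
        simpa using hintx 0
      have i1 : Integrable (fun t : ℝ => (t : ℂ) ^ (2 * k) * Complex.exp (-x * t * I)) μ := by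
        simpa using hintx (-x)
      have : 2 * H 0 - H x - H (-x) = I ^ (2 * k) * ((∫ t, a x t ∂μ : ℝ) : ℂ) := by
        rw [e0, e1, hval x hx, ← integral_complex_ofReal]
        have : ∀ t : ℝ, ((a x t : ℝ) : ℂ) = 2 * ((t : ℂ) ^ (2 * k) * Complex.exp (0 * t * I))
          - (t : ℂ) ^ (2 * k) * Complex.exp (x * t * I) - (t : ℂ) ^ (2 * k) * Complex.exp (-x * t * I) := by
          intro t
          simp only [a]
          push_cast
          rw [Complex.cos]
          simp
          ring_nf
        simp_rw [this]
        have i2 : Integrable (fun t : ℝ => 2 * ((t : ℂ) ^ (2 * k) * Complex.exp (0 * t * I))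
          - (t : ℂ) ^ (2 * k) * Complex.exp (x * t * I)) μ := (i0.const_mul 2).sub (hintx x)
        rw [integral_sub i2 i1, integral_sub (i0.const_mul 2) (hintx x), integral_const_mul]
        ring
      rw [this]
      simp
      exact integral_nonneg (ha0 x)
    let u : ℕ → ℝ := fun m => 1 / ((m : ℝ) + 1)
    have hu : Tendsto u atTop (𝓝 0) := tendsto_one_div_add_atTop_nhds_zero_nat
    have hupos : ∀ m, 0 < u m := fun m => by simp only [u]; positivity
    have hbound : ∀ᶠ m in atTop, eLpNorm (fun t => a (u m) t / (u m) ^ 2) 1 μ ≤ ENNReal.ofReal C := by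
      have hu' : Tendsto (fun m => ((u m : ℝ) : ℂ)) atTop (𝓝 0) := by
        have := (Complex.continuous_ofReal.tendsto 0).comp hu
        simpa [Function.comp_def] using this
      have hu2 : ∀ᶠ m in atTop, |u m| < r := by
        have := (continuous_abs.tendsto 0).comp hu
        simp only [abs_zero] at this
        exact this.eventually_lt_const hr
      filter_upwards [hu'.eventually hC, hu2] with m hm hm2
      rw [haint _ hm2] at hm
      rw [eLpNorm_one_eq_lintegral_enorm, ← ofReal_integral_norm_eq_lintegral_enorm ((hai _).div_const _)]
      apply ENNReal.ofReal_le_ofReal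
      have : ∀ t, ‖a (u m) t / (u m) ^ 2‖ = a (u m) t / (u m) ^ 2 := fun t =>
        Real.norm_of_nonneg (div_nonneg (ha0 _ _) (by positivity))
      simp_rw [this]
      rw [integral_div, div_le_iff₀ (by have := hupos m; positivity)]
      simpa using hm
    have hlim : ∀ᵐ t ∂μ, Tendsto (fun m => a (u m) t / (u m) ^ 2) atTop (𝓝 (t ^ (2 * (k + 1)))) := by
      filter_upwards with t
      have hs : Tendsto (fun m => Real.sinc (u m * t / 2) ^ 2 * t ^ (2 * (k + 1))) atTop
          (𝓝 (t ^ (2 * (k + 1)))) := by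
        have h1 : Tendsto (fun m => u m * t / 2) atTop (𝓝 0) := by
          simpa using (hu.mul_const t).div_const 2
        have := ((Real.continuous_sinc.tendsto 0).comp h1).pow 2 |>.mul_const (t ^ (2 * (k + 1)))
        simpa [Function.comp_def] using this
      refine hs.congr fun m => ?_
      have hum := (hupos m).ne'
      by_cases ht : t = 0
      · subst ht
        simp [a]
      · rw [Real.sinc_of_ne_zero (by positivity)]
        simp only [a]
        have : Real.cos (u m * t) = 1 - 2 * Real.sin (u m * t / 2) ^ 2 := by
          have h1 := Real.cos_two_mul (u m * t / 2)
          have h2 := Real.sin_sq_add_cos_sq (u m * t / 2)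
          rw [show 2 * (u m * t / 2) = u m * t by ring] at h1
          linarith
        rw [this]
        field_simp
        ring
    have hfin := Lp.eLpNorm_le_of_ae_tendsto hbound (fun m => ((hai _).div_const _).aestronglyMeasurable) hlim
    have hI : Integrable (fun t : ℝ => t ^ (2 * (k + 1))) μ :=
      memLp_one_iff_integrable.1 ⟨by fun_prop, hfin.trans_lt ENNReal.ofReal_lt_top⟩
    rw [← integrable_norm_rpow_iff (by fun_prop) (by simp) (ENNReal.natCast_ne_top _)]
    refine hI.congr ?_
    filter_upwards with t
    simp only [ENNReal.toReal_natCast, Real.rpow_natCast, id]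
    rw [pow_mul, pow_mul, Real.norm_eq_abs, sq_abs]

lemma exp_moment {μ : Measure ℝ} [IsFiniteMeasure μ] {F : ℂ → ℂ} {r : ℝ} (hr : 0 < r)
    (hF : DifferentiableOn ℂ F (Metric.ball 0 r)) (hφ : ∀ x : ℝ, |x| < r → charFun μ x = F x)
    (s : ℝ) (hs : |s| < r / 2) : Integrable (fun t => Real.exp (s * t)) μ := by
  have hFa : AnalyticOnNhd ℂ F (Metric.ball 0 r) := hF.analyticOnNhd Metric.isOpen_ball
  have hR : 0 < r / 2 := by positivity
  have hsub : Metric.closedBall (0 : ℂ) (r / 2) ⊆ Metric.ball 0 r :=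
    Metric.closedBall_subset_ball (by linarith)
  have hdc : DiffContOnCl ℂ F (Metric.ball 0 (r / 2)) :=
    (hF.mono (by rw [closure_ball _ hR.ne']; exact hsub)).diffContOnCl
  obtain ⟨C, hC⟩ := (isCompact_sphere (0 : ℂ) (r / 2)).exists_bound_of_continuousOn
    (hF.continuousOn.mono (Metric.sphere_subset_closedBall.trans hsub))
  have hmom : ∀ k : ℕ, Integrable (fun t : ℝ => t ^ (2 * k)) μ ∧
      ∫ t : ℝ, t ^ (2 * k) ∂μ ≤ (2 * k).factorial * C / (r / 2) ^ (2 * k) := by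
    intro k
    have hm := even_moment hr hFa hφ k
    refine ⟨?_, ?_⟩
    · refine hm.integrable_norm_pow'.congr ?_
      filter_upwards with t
      simp [pow_mul]
    · have h1 := norm_iteratedDeriv_le_of_forall_mem_sphere_norm_le (2 * k) hR hdc hC
      have h2 := iter_eq hFa hφ (2 * k) 0 (by simpa using hr)
      rw [iteratedDeriv_charFun_zero hm] at h2
      rw [ofReal_zero] at h2
      rw [← h2] at h1
      have h3 : 0 ≤ ∫ t : ℝ, t ^ (2 * k) ∂μ := integral_nonneg fun t => by
        simp only [pow_mul]; positivity
      rw [norm_mul, norm_pow, Complex.norm_I, one_pow, one_mul] at h1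
      simpa [abs_of_nonneg h3] using h1
  have hcosh : Integrable (fun t => Real.cosh (s * t)) μ := by
    refine ⟨by fun_prop, ?_⟩
    rw [hasFiniteIntegral_iff_ofReal (by filter_upwards with t using (Real.cosh_pos _).le)]
    have hnn : ∀ (k : ℕ) (t : ℝ), 0 ≤ (s * t) ^ (2 * k) / ((2 * k).factorial : ℝ) := fun k t => by
      rw [pow_mul]; positivity
    have e : ∀ t, ENNReal.ofReal (Real.cosh (s * t)) =
        ∑' k : ℕ, ENNReal.ofReal ((s * t) ^ (2 * k) / ((2 * k).factorial : ℝ)) := by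
      intro t
      rw [Real.cosh_eq_tsum, ENNReal.ofReal_tsum_of_nonneg (fun k => hnn k t)
        (Real.hasSum_cosh _).summable]
    simp_rw [e]
    rw [lintegral_tsum (fun k => by fun_prop)]
    have hb : ∀ k : ℕ, ∫⁻ t, ENNReal.ofReal ((s * t) ^ (2 * k) / ((2 * k).factorial : ℝ)) ∂μ ≤
        ENNReal.ofReal (C * ((|s| / (r / 2)) ^ 2) ^ k) := by
      intro k
      have hi : Integrable (fun t => (s * t) ^ (2 * k) / ((2 * k).factorial : ℝ)) μ := by
        simp_rw [mul_pow]
        exact ((hmom k).1.const_mul _).div_const _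
      rw [← ofReal_integral_eq_lintegral_ofReal hi (by filter_upwards with t using hnn k t)]
      apply ENNReal.ofReal_le_ofReal
      simp_rw [mul_pow]
      rw [integral_div, integral_const_mul]
      have h2 := (hmom k).2
      have h3 : 0 ≤ s ^ (2 * k) := by rw [pow_mul]; positivity
      have hf : (0 : ℝ) < (2 * k).factorial := by positivity
      calc s ^ (2 * k) * (∫ t : ℝ, t ^ (2 * k) ∂μ) / (2 * k).factorial
          ≤ s ^ (2 * k) * ((2 * k).factorial * C / (r / 2) ^ (2 * k)) / (2 * k).factorial := by gcongr
        _ = C * ((|s| / (r / 2)) ^ 2) ^ k := by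
          have h4 : ((|s| / (r / 2)) ^ 2) ^ k = s ^ (2 * k) / (r / 2) ^ (2 * k) := by
            rw [div_pow |s|, sq_abs, div_pow (s ^ 2), ← pow_mul, ← pow_mul]
          rw [h4]
          field_simp
    refine (ENNReal.tsum_le_tsum hb).trans_lt ?_
    have hsum : Summable (fun k : ℕ => C * ((|s| / (r / 2)) ^ 2) ^ k) := by
      apply Summable.mul_left
      apply summable_geometric_of_lt_one (by positivity)
      have : |s| / (r / 2) < 1 := by rwa [div_lt_one hR]
      have h0 : 0 ≤ |s| / (r / 2) := by positivity
      nlinarith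
    exact hsum.tsum_ofReal_lt_top
  refine (hcosh.const_mul 2).mono (by fun_prop) ?_
  filter_upwards with t
  rw [Real.norm_of_nonneg (Real.exp_pos _).le, Real.norm_of_nonneg (by have := Real.cosh_pos (s * t); positivity)]
  rw [Real.cosh_eq]
  linarith [Real.exp_pos (-(s * t))]

open ProbabilityTheory in
lemma cmgf_analytic {μ : Measure ℝ} {ρ : ℝ}
    (h : ∀ s : ℝ, |s| < ρ → Integrable (fun t => Real.exp (s * t)) μ) :
    AnalyticOnNhd ℂ (fun z => complexMGF id μ (z * I)) {z | |z.im| < ρ} := by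
  intro z hz
  have hz' : |z.im| < ρ := hz
  have h1 : (z * I).re ∈ interior (integrableExpSet id μ) := by
    have hsub : {s : ℝ | |s| < ρ} ⊆ integrableExpSet id μ := fun s hs => h s hs
    have hop : IsOpen {s : ℝ | |s| < ρ} := isOpen_lt continuous_abs continuous_const
    exact interior_maximal hsub hop (by simpa using hz')
  have h2 := analyticAt_complexMGF h1
  exact AnalyticAt.fun_comp (g := complexMGF id μ) (f := fun z => z * I) h2 (by fun_prop)

lemma real_ident {G H : ℂ → ℂ} {U : Set ℂ} (hG : AnalyticOnNhd ℂ G U) (hH : AnalyticOnNhd ℂ H U)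
    (hU : IsPreconnected U) (h0 : (0 : ℂ) ∈ U) {ε : ℝ} (hε : 0 < ε)
    (h : ∀ x : ℝ, |x| < ε → G x = H x) : EqOn G H U := by
  refine hG.eqOn_of_preconnected_of_frequently_eq hH hU h0 ?_
  have ht : Tendsto (fun x : ℝ => (x : ℂ)) (𝓝[≠] 0) (𝓝[≠] 0) := by
    refine tendsto_nhdsWithin_iff.2 ⟨?_, ?_⟩
    · have := Complex.continuous_ofReal.tendsto 0
      rw [ofReal_zero] at this
      exact this.mono_left nhdsWithin_le_nhds
    · filter_upwards [self_mem_nhdsWithin] with x hx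
      simpa using hx
  refine ht.frequently (Eventually.frequently ?_)
  have : ∀ᶠ x : ℝ in 𝓝 0, |x| < ε :=
    continuous_abs.continuousAt.eventually_lt_const (by simpa using hε)
  filter_upwards [nhdsWithin_le_nhds this] with x hx using h x hx

lemma strip_preconnected (ρ : ℝ) : IsPreconnected {z : ℂ | |z.im| < ρ} := by
  have : {z : ℂ | |z.im| < ρ} = Complex.imLm ⁻¹' (Metric.ball (0 : ℝ) ρ) := by
    ext z; simp
  rw [this]
  exact ((convex_ball (0 : ℝ) ρ).linear_preimage Complex.imLm).isPreconnected

open ProbabilityTheory in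
lemma measure_unique {μ ν : Measure ℝ} [IsFiniteMeasure μ] [IsFiniteMeasure ν] {ρ : ℝ} (hρ : 0 < ρ)
    (hμ : ∀ s : ℝ, |s| < ρ → Integrable (fun t => Real.exp (s * t)) μ)
    (hν : ∀ s : ℝ, |s| < ρ → Integrable (fun t => Real.exp (s * t)) ν)
    {ε : ℝ} (hε : 0 < ε) (h : ∀ x : ℝ, |x| < ε → charFun μ x = charFun ν x) : μ = ν := by
  apply Measure.ext_of_charFun
  have key := real_ident (cmgf_analytic hμ) (cmgf_analytic hν) (strip_preconnected ρ)
    (by simpa using hρ) hε (fun x hx => by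
      rw [complexMGF_id_mul_I, complexMGF_id_mul_I]; exact h x hx)
  ext x
  have := key (show (x : ℂ) ∈ {z : ℂ | |z.im| < ρ} by simpa using hρ)
  simpa only [complexMGF_id_mul_I] using this

/-- Exponential reweighting of a measure. -/
def expTilt (μ : Measure ℝ) (s : ℝ) : Measure ℝ :=
  μ.withDensity (fun t => ENNReal.ofReal (Real.exp (s * t)))

lemma expTilt_expTilt (μ : Measure ℝ) (s r : ℝ) : expTilt (expTilt μ s) r = expTilt μ (s + r) := by
  unfold expTilt
  rw [← withDensity_mul _ (by fun_prop) (by fun_prop)]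
  congr 1
  ext t
  rw [Pi.mul_apply, ← ENNReal.ofReal_mul (Real.exp_pos _).le, ← Real.exp_add, add_mul]

lemma expTilt_zero (μ : Measure ℝ) : expTilt μ 0 = μ := by
  unfold expTilt
  simp

lemma integrable_expTilt {μ : Measure ℝ} (s r : ℝ) :
    Integrable (fun t => Real.exp (r * t)) (expTilt μ s) ↔
      Integrable (fun t => Real.exp ((s + r) * t)) μ := by
  unfold expTilt
  rw [integrable_withDensity_iff_integrable_smul' (by fun_prop) (by simp)]
  refine iff_of_eq (congrArg (fun g => Integrable g μ) ?_)
  ext t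
  rw [ENNReal.toReal_ofReal (Real.exp_pos _).le, smul_eq_mul, ← Real.exp_add, add_mul]

lemma finite_expTilt {μ : Measure ℝ} {s : ℝ} (h : Integrable (fun t => Real.exp (s * t)) μ) :
    IsFiniteMeasure (expTilt μ s) := isFiniteMeasure_withDensity_ofReal h.2

lemma integral_expTilt (μ : Measure ℝ) (s : ℝ) (g : ℝ → ℂ) :
    ∫ t, g t ∂(expTilt μ s) = ∫ t, Complex.exp (s * t) * g t ∂μ := by
  unfold expTilt
  rw [integral_withDensity_eq_integral_toReal_smul (by fun_prop) (by simp)]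
  congr 1
  ext t
  rw [ENNReal.toReal_ofReal (Real.exp_pos _).le, Complex.real_smul]
  push_cast
  rfl

lemma charFun_expTilt (μ : Measure ℝ) (s x : ℝ) :
    charFun (expTilt μ s) x = ∫ t : ℝ, Complex.exp ((s + x * I) * t) ∂μ := by
  rw [charFun_apply_real, integral_expTilt]
  congr 1
  ext t
  rw [← Complex.exp_add]
  ring_nf

open ProbabilityTheory in
lemma local_tilt {f : ℂ → ℂ} {y r : ℝ} (hr : 0 < r)
    (hf : DifferentiableOn ℂ f (Metric.ball (y * I) r)) {μ μ' : Measure ℝ} [IsFiniteMeasure μ]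
    [IsFiniteMeasure μ'] (hμ : ∀ x : ℝ, charFun μ x = f (x + y * I)) {y' : ℝ}
    (hy' : |y' - y| < r / 4) (hμ' : ∀ x : ℝ, charFun μ' x = f (x + y' * I)) :
    expTilt μ (y - y') = μ' := by
  have hF : DifferentiableOn ℂ (fun z => f (z + y * I)) (Metric.ball 0 r) := by
    refine hf.comp (by fun_prop) ?_
    intro z hz
    simpa using hz
  have hF' : DifferentiableOn ℂ (fun z => f (z + y' * I)) (Metric.ball 0 (r / 2)) := by
    refine hf.comp (by fun_prop) ?_
    intro z hz
    rw [mem_ball_zero_iff] at hz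
    rw [mem_ball_iff_norm]
    have e : z + y' * I - y * I = z + ((y' - y : ℝ) : ℂ) * I := by push_cast; ring
    rw [e]
    refine (norm_add_le _ _).trans_lt ?_
    rw [norm_mul, Complex.norm_I, mul_one, Complex.norm_real, Real.norm_eq_abs]
    linarith
  have m1 := exp_moment (F := fun z => f (z + y * I)) hr hF (fun x _ => hμ x)
  have m2 := exp_moment (F := fun z => f (z + y' * I)) (half_pos hr) hF' (fun x _ => hμ' x)
  have hfin : IsFiniteMeasure (expTilt μ (y - y')) :=
    finite_expTilt (m1 _ (by rw [abs_sub_comm]; linarith))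
  have hbs : Metric.ball (0 : ℂ) (r / 2) ⊆ {z : ℂ | |z.im| < r / 2} := by
    intro z hz
    rw [mem_ball_zero_iff] at hz
    exact (Complex.abs_im_le_norm z).trans_lt hz
  have key := real_ident ((cmgf_analytic m1).mono hbs)
    ((hF.analyticOnNhd Metric.isOpen_ball).mono (Metric.ball_subset_ball (by linarith)))
    (convex_ball (0 : ℂ) (r / 2)).isPreconnected (by simpa using hr) hr (fun x _ => by
      rw [complexMGF_id_mul_I, hμ])
  refine measure_unique (ρ := r / 4) (ε := r / 4) (by positivity) ?_ ?_ (by positivity) ?_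
  · intro s hs
    rw [integrable_expTilt]
    apply m1
    rw [abs_lt] at *
    constructor <;> linarith
  · intro s hs
    apply m2
    linarith
  · intro x hx
    rw [charFun_expTilt, hμ']
    have hmem : (x : ℂ) + ((y' - y : ℝ) : ℂ) * I ∈ Metric.ball (0 : ℂ) (r / 2) := by
      rw [mem_ball_zero_iff]
      refine (norm_add_le _ _).trans_lt ?_
      rw [norm_mul, Complex.norm_I, mul_one, Complex.norm_real, Complex.norm_real,
        Real.norm_eq_abs, Real.norm_eq_abs]
      linarith
    have := key hmem
    simp only [complexMGF, id] at this
    rw [show (x : ℂ) + ((y' - y : ℝ) : ℂ) * I + y * I = x + y' * I by push_cast; ring] at this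
    rw [← this]
    congr 1
    ext t
    congr 2
    push_cast
    linear_combination (-(y' : ℂ) + y) * I_mul_I

/-- If `f` is positive definite on the horizontal strip `S_{a,b}` and holomorphic on an open set
containing the segment `{iy : a < y < b}` of the imaginary axis, then `f` is holomorphic on all
of `S_{a,b}` and is the Fourier–Laplace transform of a unique exponentially finite measure. -/
theorem stmt9 (a b : EReal) (hab : a < b) (f : ℂ → ℂ)
    (hpd : IsPosDefOnC f (HStrip a b))
    (Ω : Set ℂ) (hΩ : IsOpen Ω)
    (hΓ : (fun y : ℝ => (y : ℂ) * I) '' {y : ℝ | a < (y : EReal) ∧ (y : EReal) < b} ⊆ Ω)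
    (hf : DifferentiableOn ℂ f Ω) :
    DifferentiableOn ℂ f (HStrip a b) ∧
    ∃! μ : Measure ℝ, ExpFinite μ a b ∧
      ∀ z ∈ HStrip a b, f z = ∫ t : ℝ, Complex.exp (I * z * t) ∂μ := by
  set J : Set ℝ := {y : ℝ | a < (y : EReal) ∧ (y : EReal) < b} with hJ
  have hJopen : IsOpen J :=
    (isOpen_lt continuous_const continuous_coe_real_ereal).inter
      (isOpen_lt continuous_coe_real_ereal continuous_const)
  have hJpre : IsPreconnected J := by
    apply Set.OrdConnected.isPreconnected
    refine ⟨fun x hx y hy z hz => ⟨?_, ?_⟩⟩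
    · exact hx.1.trans_le (EReal.coe_le_coe_iff.2 hz.1)
    · exact (EReal.coe_le_coe_iff.2 hz.2).trans_lt hy.2
  obtain ⟨y0, hy0⟩ : J.Nonempty := by
    obtain ⟨y, h1, h2⟩ := EReal.lt_iff_exists_real_btwn.1 hab
    exact ⟨y, h1, h2⟩
  have hΓ' : ∀ y ∈ J, ∃ r > 0, Metric.ball ((y : ℂ) * I) r ⊆ Ω := fun y hy =>
    Metric.isOpen_iff.1 hΩ _ (hΓ ⟨y, hy, rfl⟩)
  have hex : ∀ y : ℝ, ∃ ν : Measure ℝ, y ∈ J → IsFiniteMeasure ν ∧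
      ∀ x : ℝ, charFun ν x = f (x + y * I) := by
    intro y
    by_cases hy : y ∈ J
    swap
    · exact ⟨0, fun h => absurd h hy⟩
    have hg : IsPosDefFun (fun x : ℝ => f (x + y * I)) := by
      intro n x ξ
      have e : ∀ k l, ((x k : ℂ) + (y / 2 : ℝ) * I) - (starRingEnd ℂ) ((x l : ℂ) + (y / 2 : ℝ) * I)
          = ((x k - x l : ℝ) : ℂ) + y * I := by
        intro k l
        simp only [map_add, map_mul, Complex.conj_ofReal, Complex.conj_I]
        push_cast
        ring
      have := hpd n (fun k => (x k : ℂ) + (y / 2 : ℝ) * I) (fun k l => by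
        rw [e]
        simpa [HStrip] using (show _ ∧ _ from hy)) ξ
      simpa only [e] using this
    have hc : ContinuousAt (fun x : ℝ => f (x + y * I)) 0 := by
      have h1 : ContinuousAt f (((0 : ℝ) : ℂ) + y * I) := by
        rw [ofReal_zero, zero_add]
        exact (hf.differentiableAt (hΩ.mem_nhds (hΓ ⟨y, hy, rfl⟩))).continuousAt
      exact ContinuousAt.comp (g := f) (f := fun x : ℝ => (x : ℂ) + y * I) h1 (by fun_prop)
    obtain ⟨ν, h1, h2⟩ := bochner hg hc
    exact ⟨ν, fun _ => ⟨h1, h2⟩⟩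
  choose μ hμ using hex
  have hconst : ∀ y ∈ J, expTilt (μ y0) y0 = expTilt (μ y) y := by
    intro y hy
    refine hJpre.induction₂ (fun x y => expTilt (μ x) x = expTilt (μ y) y) ?_ ?_ ?_ hy0 hy
    · intro x hx
      obtain ⟨r, hr, hball⟩ := hΓ' x hx
      have h1 : ∀ᶠ y in 𝓝 x, |y - x| < r / 4 := by
        have : Continuous fun y => |y - x| := by fun_prop
        exact this.continuousAt.eventually_lt_const (by simpa using hr)
      filter_upwards [nhdsWithin_le_nhds h1, self_mem_nhdsWithin] with y hyx hyJ
      have := (hμ x hx).1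
      have := (hμ y hyJ).1
      rw [← local_tilt hr (hf.mono hball) (hμ x hx).2 hyx (hμ y hyJ).2, expTilt_expTilt]
      congr 1
      ring
    · intro x y z _ _ _ h1 h2
      exact h1.trans h2
    · intro x y _ _ h
      exact h.symm
  set M := expTilt (μ y0) y0 with hM
  have htilt : ∀ y ∈ J, expTilt M (-y) = μ y := by
    intro y hy
    rw [hconst y hy, expTilt_expTilt, add_neg_cancel, expTilt_zero]
  have hMexp : ExpFinite M a b := by
    intro y h1 h2
    have hy : y ∈ J := ⟨h1, h2⟩
    have := (hμ y hy).1
    have h3 : Integrable (fun t => Real.exp (0 * t)) (expTilt M (-y)) := by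
      rw [htilt y hy]
      simp
    rw [integrable_expTilt, add_zero] at h3
    exact h3
  have hrep : ∀ z ∈ HStrip a b, f z = ∫ t : ℝ, Complex.exp (I * z * t) ∂M := by
    intro z hz
    have hy : z.im ∈ J := hz
    have h1 := (hμ _ hy).2 z.re
    rw [Complex.re_add_im, ← htilt _ hy, charFun_expTilt] at h1
    rw [← h1]
    congr 1
    ext t
    congr 2
    conv_rhs => rw [← Complex.re_add_im z]
    push_cast
    linear_combination (-(z.im : ℂ)) * I_mul_I
  refine ⟨?_, M, ⟨hMexp, hrep⟩, ?_⟩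
  · have hd : DifferentiableOn ℂ (fun z => ProbabilityTheory.complexMGF id M (I * z)) (HStrip a b) := by
      intro z hz
      have hy : z.im ∈ J := hz
      have h1 : (I * z).re ∈ interior (ProbabilityTheory.integrableExpSet id M) := by
        have hsub : (fun s : ℝ => -s) ⁻¹' J ⊆ ProbabilityTheory.integrableExpSet id M := fun s hs => by
          have := hMexp (-s) hs.1 hs.2
          rw [neg_neg] at this
          exact this
        exact interior_maximal hsub (hJopen.preimage continuous_neg) (by simpa using hy)
      have h2 := (ProbabilityTheory.hasDerivAt_complexMGF h1).differentiableAt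
      exact (DifferentiableAt.comp (g := ProbabilityTheory.complexMGF id M) (f := fun z => I * z) z h2
        (by fun_prop)).differentiableWithinAt
    exact hd.congr fun z hz => hrep z hz
  · rintro N ⟨hN1, hN2⟩
    have hNfin : IsFiniteMeasure (expTilt N (-y0)) := finite_expTilt (hN1 y0 hy0.1 hy0.2)
    have hMfin : IsFiniteMeasure (expTilt M (-y0)) := finite_expTilt (hMexp y0 hy0.1 hy0.2)
    have heq : expTilt N (-y0) = expTilt M (-y0) := by
      apply Measure.ext_of_charFun
      ext x
      rw [charFun_expTilt, charFun_expTilt]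
      have hz : (x : ℂ) + y0 * I ∈ HStrip a b := by simpa [HStrip] using (show _ ∧ _ from hy0)
      have h1 := (hN2 _ hz).symm.trans (hrep _ hz)
      have e : ∀ t : ℝ, (((-y0 : ℝ) : ℂ) + x * I) * t = I * (x + y0 * I) * t := by
        intro t
        push_cast
        linear_combination (-(y0 : ℂ) * t) * I_mul_I
      simp_rw [e]
      exact h1
    have h2 := congrArg (fun m => expTilt m y0) heq
    simpa only [expTilt_expTilt, neg_add_cancel, expTilt_zero] using h2
end
end

section
/- Let μ be a nonnegative Borel measure on ℝ. Then the following are equivalent: (1) there exists ε > 0 such that ∫ℝ e^{−yt} dμ(t) < ∞ for every y ∈ (−ε, ε); (2) μ is finite and its characteristic function h(x) = ∫ℝ e^{ixt} dμ(t) is real-analytic on some open neighborhood of 0; (3) there exists δ > 0 such that the moment generating function g(u) = ∫ℝ e^{ut} dμ(t) is finite for every u ∈ (−δ, δ). -/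
open Complex MeasureTheory Filter Set Topology
open scoped Real BigOperators ComplexOrder

noncomputable section

section helpers
open Asymptotics

lemma aux_fwd (N m : ℕ) (y : ℂ) (hm : m ≤ N) :
    ∑ k ∈ Finset.range (N + 1), (((-1) ^ (N - k) * (N.choose k : ℤ) : ℤ) : ℂ) * (y + k) ^ m
      = if m = N then (N.factorial : ℂ) else 0 := by
  have h := fwdDiff_iter_eq_sum_shift (1 : ℂ) (fun r : ℂ => r ^ m) N y
  simp only [zsmul_eq_mul, nsmul_eq_mul, mul_one] at h
  rw [← h]
  split_ifs with hmN
  · subst hmN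
    rw [fwdDiff_iter_eq_factorial]; rfl
  · rw [fwdDiff_iter_pow_eq_zero_of_lt (lt_of_le_of_ne hm hmN)]; rfl

lemma aux_point (n : ℕ) (θ : ℝ) :
    ∑ k ∈ Finset.range (2 * n + 1), (((-1) ^ (2 * n - k) * ((2 * n).choose k : ℤ) : ℤ) : ℂ) *
      Complex.exp (I * ((-(n:ℂ) + k) * θ)) = (-1) ^ n * (((2 - 2 * Real.cos θ) ^ n : ℝ) : ℂ) := by
  have h1 : Complex.exp (-(I * θ)) * (Complex.exp (I * θ) - 1) ^ 2 = -(2 - 2 * Complex.cos θ) := by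
    rw [Complex.cos, Complex.exp_neg, mul_comm (θ : ℂ) I, neg_mul, mul_comm (θ : ℂ) I,
      Complex.exp_neg]
    field_simp [Complex.exp_ne_zero]
    ring
  have h2 : (-1) ^ n * (((2 - 2 * Real.cos θ) ^ n : ℝ) : ℂ)
      = Complex.exp (-(I * θ)) ^ n * (Complex.exp (I * θ) + (-1)) ^ (2 * n) := by
    rw [pow_mul, ← mul_pow, ← sub_eq_add_neg, h1]
    push_cast
    rw [← mul_pow]; ring
  rw [h2, add_pow, Finset.mul_sum]
  refine Finset.sum_congr rfl fun k _ => ?_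
  rw [← Complex.exp_nat_mul, ← Complex.exp_nat_mul]
  have : I * ((-(n:ℂ) + k) * θ) = n * -(I * θ) + k * (I * θ) := by ring
  rw [this, Complex.exp_add]
  push_cast
  ring

/-- the symmetric difference of the characteristic function -/
lemma aux_D (μ : Measure ℝ) [IsFiniteMeasure μ] (n : ℕ) (x : ℝ) :
    ∑ k ∈ Finset.range (2 * n + 1), (((-1) ^ (2 * n - k) * ((2 * n).choose k : ℤ) : ℤ) : ℂ) *
      (∫ t : ℝ, Complex.exp (I * (((-(n:ℝ) + k) * x : ℝ) : ℂ) * t) ∂μ)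
      = (-1) ^ n * ((∫ t : ℝ, (2 - 2 * Real.cos (x * t)) ^ n ∂μ : ℝ) : ℂ) := by
  rw [← integral_complex_ofReal, ← integral_const_mul]
  simp_rw [← aux_point, ← integral_const_mul]
  rw [← integral_finsetSum]
  · refine integral_congr_ae (Eventually.of_forall fun t => ?_)
    refine Finset.sum_congr rfl fun k _ => ?_
    push_cast
    congr 2; ring
  · intro k _
    refine Integrable.const_mul ?_ _
    refine Integrable.mono' (integrable_const (1:ℝ)) (by fun_prop) (Eventually.of_forall fun t => ?_)
    rw [Complex.norm_exp]; simp

lemma aux_tendsto {h : ℝ → ℂ} {p : FormalMultilinearSeries ℝ ℝ ℂ} (hp : HasFPowerSeriesAt h p 0)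
    (n : ℕ) :
    Tendsto (fun x : ℝ => (∑ k ∈ Finset.range (2 * n + 1),
      (((-1) ^ (2 * n - k) * ((2 * n).choose k : ℤ) : ℤ) : ℂ) * h ((-(n:ℝ) + k) * x))
        / (x : ℂ) ^ (2 * n)) (𝓝[≠] 0) (𝓝 ((2 * n).factorial * p.coeff (2 * n))) := by
  set c : ℕ → ℂ := fun k => (((-1) ^ (2 * n - k) * ((2 * n).choose k : ℤ) : ℤ) : ℂ) with hc
  set R : ℝ → ℂ := fun y => h y - p.partialSum (2 * n + 1) y with hR
  have hRO : R =O[𝓝 0] fun y => ‖y‖ ^ (2 * n + 1) := by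
    simpa [hR] using hp.isBigO_sub_partialSum_pow (2 * n + 1)
  have hmain : ∀ x : ℝ, ∑ k ∈ Finset.range (2 * n + 1), c k * h ((-(n:ℝ) + k) * x)
      = (2 * n).factorial * p.coeff (2 * n) * (x : ℂ) ^ (2 * n) +
        ∑ k ∈ Finset.range (2 * n + 1), c k * R ((-(n:ℝ) + k) * x) := by
    intro x
    have e1 : ∑ k ∈ Finset.range (2 * n + 1), c k * p.partialSum (2 * n + 1) ((-(n:ℝ) + k) * x)
        = (2 * n).factorial * p.coeff (2 * n) * (x : ℂ) ^ (2 * n) := by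
      simp only [FormalMultilinearSeries.partialSum,
        FormalMultilinearSeries.apply_eq_pow_smul_coeff, Complex.real_smul]
      simp_rw [Finset.mul_sum]
      rw [Finset.sum_comm]
      have e2 : ∀ m ∈ Finset.range (2 * n + 1), ∑ k ∈ Finset.range (2 * n + 1),
          c k * ((((-(n:ℝ) + k) * x) ^ m : ℝ) * p.coeff m)
          = if m = 2 * n then ((2 * n).factorial : ℂ) * p.coeff (2 * n) * (x : ℂ) ^ (2 * n)
            else 0 := by
        intro m hm
        have := aux_fwd (2 * n) m (-(n:ℂ)) (by simpa [Nat.lt_succ_iff] using hm)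
        have e3 : ∑ k ∈ Finset.range (2 * n + 1),
          c k * ((((-(n:ℝ) + k) * x) ^ m : ℝ) * p.coeff m)
          = (∑ k ∈ Finset.range (2 * n + 1), c k * (-(n:ℂ) + k) ^ m) * (p.coeff m * (x:ℂ) ^ m) := by
          rw [Finset.sum_mul]
          refine Finset.sum_congr rfl fun k _ => ?_
          push_cast; rw [mul_pow]; ring
        rw [e3, this]
        split_ifs with hm2
        · subst hm2; ring
        · simp
      rw [Finset.sum_congr rfl e2]
      simp
    rw [← e1, ← Finset.sum_add_distrib]
    refine Finset.sum_congr rfl fun k _ => ?_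
    simp only [hR]; ring
  have hO : (fun x : ℝ => ∑ k ∈ Finset.range (2 * n + 1), c k * R ((-(n:ℝ) + k) * x))
      =O[𝓝 0] fun x : ℝ => ‖x‖ ^ (2 * n + 1) := by
    refine IsBigO.fun_sum fun k _ => IsBigO.const_mul_left ?_ _
    have ht : Tendsto (fun x : ℝ => (-(n:ℝ) + k) * x) (𝓝 0) (𝓝 0) := by
      have : Continuous (fun x : ℝ => (-(n:ℝ) + k) * x) := by fun_prop
      simpa using this.tendsto 0
    refine (hRO.comp_tendsto ht).trans ?_
    simp only [Function.comp_def, norm_mul, mul_pow]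
    exact (isBigO_refl _ _).const_mul_left _
  have hT : Tendsto (fun x : ℝ => (∑ k ∈ Finset.range (2 * n + 1), c k * R ((-(n:ℝ) + k) * x))
      / (x : ℂ) ^ (2 * n)) (𝓝[≠] 0) (𝓝 0) := by
    have h1 : (fun x : ℝ => (∑ k ∈ Finset.range (2 * n + 1), c k * R ((-(n:ℝ) + k) * x))
      / (x : ℂ) ^ (2 * n)) =O[𝓝[≠] 0] fun x : ℝ => x := by
      obtain ⟨C, hC⟩ := (hO.mono (nhdsWithin_le_nhds (s := {0}ᶜ))).bound
      refine IsBigO.of_bound C ?_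
      filter_upwards [hC, self_mem_nhdsWithin] with x hx hx0
      have hx0' : 0 < ‖x‖ := norm_pos_iff.2 hx0
      rw [norm_div, norm_pow, Complex.norm_real, div_le_iff₀ (by positivity)]
      refine hx.trans (le_of_eq ?_)
      rw [norm_pow, norm_norm]; ring
    exact h1.trans_tendsto (tendsto_nhdsWithin_of_tendsto_nhds tendsto_id)
  have h2 := (tendsto_const_nhds (x := ((2 * n).factorial * p.coeff (2 * n) : ℂ))).add hT
  rw [add_zero] at h2
  refine h2.congr' ?_
  filter_upwards [self_mem_nhdsWithin] with x hx0
  have : (x : ℂ) ≠ 0 := by exact_mod_cast hx0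
  rw [hmain x, add_div, mul_div_cancel_right₀ _ (pow_ne_zero _ this)]

lemma aux_cos (n : ℕ) (t : ℝ) :
    Tendsto (fun x : ℝ => (2 - 2 * Real.cos (x * t)) ^ n / x ^ (2 * n)) (𝓝[≠] 0)
      (𝓝 (t ^ (2 * n))) := by
  have h1 : HasDerivAt (fun x : ℝ => 2 * Real.sin (x * t / 2)) t 0 := by
    have := (((hasDerivAt_id (0:ℝ)).mul_const t).div_const 2).sin.const_mul 2
    simpa [mul_div_cancel₀] using this
  rw [hasDerivAt_iff_tendsto_slope_zero] at h1
  have h2 := h1.pow (2 * n)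
  refine h2.congr fun x => ?_
  have h3 : 2 - 2 * Real.cos (x * t) = (2 * Real.sin (x * t / 2)) ^ 2 := by
    have := Real.cos_sq_add_sin_sq (x * t / 2)
    have h4 := Real.cos_two_mul (x * t / 2)
    rw [mul_div_cancel₀ _ (two_ne_zero)] at h4
    rw [h4]; linear_combination -4 * this
  rw [h3, ← pow_mul]
  simp [div_eq_mul_inv, mul_pow, mul_comm]

lemma aux_moment (μ : Measure ℝ) [IsFiniteMeasure μ] {p : FormalMultilinearSeries ℝ ℝ ℂ}
    (hp : HasFPowerSeriesAt (fun x : ℝ => ∫ t : ℝ, Complex.exp (I * (x : ℂ) * t) ∂μ) p 0) (n : ℕ) :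
    ∫⁻ t, ENNReal.ofReal (t ^ (2 * n)) ∂μ
      ≤ ENNReal.ofReal ((2 * n).factorial * ‖p.coeff (2 * n)‖) := by
  have h1 := (aux_tendsto hp n).norm
  simp_rw [aux_D] at h1
  have hnn : ∀ x t : ℝ, 0 ≤ (2 - 2 * Real.cos (x * t)) ^ n := fun x t =>
    pow_nonneg (by linarith [Real.cos_le_one (x * t)]) n
  have hxn : ∀ x : ℝ, 0 ≤ x ^ (2 * n) := fun x => by rw [pow_mul]; positivity
  have hint : ∀ x : ℝ, Integrable (fun t : ℝ => (2 - 2 * Real.cos (x * t)) ^ n) μ := by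
    intro x
    refine Integrable.mono' (integrable_const ((4:ℝ) ^ n)) (by fun_prop)
      (Eventually.of_forall fun t => ?_)
    rw [Real.norm_of_nonneg (hnn x t)]
    exact pow_le_pow_left₀ (by linarith [Real.cos_le_one (x * t)])
      (by linarith [Real.neg_one_le_cos (x * t)]) n
  have h2 : ∀ x : ℝ, ENNReal.ofReal ‖(-1) ^ n * ((∫ t : ℝ, (2 - 2 * Real.cos (x * t)) ^ n ∂μ : ℝ) : ℂ)
      / (x : ℂ) ^ (2 * n)‖
      = ∫⁻ t, ENNReal.ofReal ((2 - 2 * Real.cos (x * t)) ^ n / x ^ (2 * n)) ∂μ := by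
    intro x
    rw [← ofReal_integral_eq_lintegral_ofReal ((hint x).div_const _)
      (Eventually.of_forall fun t => div_nonneg (hnn x t) (hxn x)), integral_div]
    congr 1
    rw [norm_div, norm_mul, norm_pow, norm_pow, norm_neg, norm_one, one_pow, one_mul,
      Complex.norm_real, Complex.norm_real,
      Real.norm_of_nonneg (integral_nonneg fun t => hnn x t), ← norm_pow,
      Real.norm_of_nonneg (hxn x)]
  have h3 := ENNReal.tendsto_ofReal h1
  simp_rw [h2] at h3
  rw [norm_mul, Complex.norm_natCast] at h3
  rw [← h3.liminf_eq]
  refine le_trans (le_of_eq ?_) (lintegral_liminf_le fun x => by fun_prop)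
  refine lintegral_congr fun t => ?_
  exact (ENNReal.tendsto_ofReal (aux_cos n t)).liminf_eq.symm

lemma aux_hard (μ : Measure ℝ) [IsFiniteMeasure μ]
    (ha : AnalyticAt ℝ (fun x : ℝ => ∫ t : ℝ, Complex.exp (I * (x : ℂ) * t) ∂μ) 0) :
    ∃ δ : ℝ, 0 < δ ∧ ∀ u ∈ Set.Ioo (-δ) δ, Integrable (fun t : ℝ => Real.exp (u * t)) μ := by
  obtain ⟨p, hp⟩ := ha
  obtain ⟨r, hr0, hr⟩ := ENNReal.lt_iff_exists_nnreal_btwn.1 hp.radius_pos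
  have hr0' : (0:ℝ) < r := by exact_mod_cast hr0
  refine ⟨r, hr0', fun u hu => ?_⟩
  have hsum := p.summable_norm_mul_pow hr
  have hsum2 : Summable fun n : ℕ => ‖p.coeff (2 * n)‖ * u ^ (2 * n) := by
    have := hsum.comp_injective (i := fun n : ℕ => 2 * n) (fun a b h => by simpa using h)
    refine this.of_nonneg_of_le (fun n => by rw [pow_mul]; positivity) fun n => ?_
    simp only [Function.comp, FormalMultilinearSeries.norm_apply_eq_norm_coef]
    refine mul_le_mul_of_nonneg_left ?_ (norm_nonneg _)
    rw [pow_mul, pow_mul]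
    refine pow_le_pow_left₀ (sq_nonneg _) ?_ n
    exact sq_le_sq' hu.1.le hu.2.le
  have hcosh : ∫⁻ t, ENNReal.ofReal (Real.cosh (u * t)) ∂μ < ⊤ := by
    have e : ∀ t : ℝ, ENNReal.ofReal (Real.cosh (u * t))
        = ∑' n : ℕ, ENNReal.ofReal (u ^ (2 * n) / (2 * n).factorial) *
          ENNReal.ofReal (t ^ (2 * n)) := by
      intro t
      have hs := Real.hasSum_cosh (u * t)
      rw [← hs.tsum_eq, ENNReal.ofReal_tsum_of_nonneg (fun n => by rw [pow_mul]; positivity)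
        hs.summable]
      refine tsum_congr fun n => ?_
      rw [← ENNReal.ofReal_mul (by rw [pow_mul]; positivity)]
      congr 1; rw [mul_pow]; ring
    simp_rw [e]
    rw [lintegral_tsum fun n => by fun_prop]
    refine lt_of_le_of_lt (b := ∑' n : ℕ, ENNReal.ofReal (‖p.coeff (2 * n)‖ * u ^ (2 * n))) ?_ ?_
    · refine ENNReal.tsum_le_tsum fun n => ?_
      rw [lintegral_const_mul _ (by fun_prop)]
      refine (mul_le_mul_right (aux_moment μ hp n) _).trans (le_of_eq ?_)
      rw [← ENNReal.ofReal_mul (by rw [pow_mul]; positivity)]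
      congr 1
      have : ((2 * n).factorial : ℝ) ≠ 0 := by positivity
      field_simp
    · rw [← ENNReal.ofReal_tsum_of_nonneg (fun n => by rw [pow_mul]; positivity) hsum2]
      exact ENNReal.ofReal_lt_top
  have hci : Integrable (fun t : ℝ => Real.cosh (u * t)) μ := by
    refine ⟨(Real.continuous_cosh.comp (continuous_const.mul continuous_id)).aestronglyMeasurable, ?_⟩
    rw [hasFiniteIntegral_iff_ofReal (Eventually.of_forall fun t => (Real.cosh_pos _).le)]
    exact hcosh
  refine (hci.const_mul 2).mono' (by fun_prop) (Eventually.of_forall fun t => ?_)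
  rw [Real.norm_of_nonneg (Real.exp_pos _).le, Real.cosh_eq]
  linarith [Real.exp_pos (-(u * t))]

lemma aux_easy (μ : Measure ℝ)
    (h : ∃ δ : ℝ, 0 < δ ∧ ∀ u ∈ Set.Ioo (-δ) δ, Integrable (fun t : ℝ => Real.exp (u * t)) μ) :
    IsFiniteMeasure μ ∧ ∀ x : ℝ,
      AnalyticAt ℝ (fun x : ℝ => ∫ t : ℝ, Complex.exp (I * (x : ℂ) * t) ∂μ) x := by
  obtain ⟨δ, hδ, h⟩ := h
  have h0 := h 0 ⟨by linarith, hδ⟩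
  refine ⟨by simpa [integrable_const_iff] using h0, fun x => ?_⟩
  have hz : (0:ℝ) ∈ interior (ProbabilityTheory.integrableExpSet (id : ℝ → ℝ) μ) := by
    rw [mem_interior]
    exact ⟨Set.Ioo (-δ) δ, fun u hu => h u hu, isOpen_Ioo, by linarith, hδ⟩
  have h1 : AnalyticAt ℂ (ProbabilityTheory.complexMGF (id : ℝ → ℝ) μ) (I * (x : ℂ)) :=
    ProbabilityTheory.analyticAt_complexMGF (by simpa using hz)
  have h2 : AnalyticAt ℝ (fun x : ℝ => I * (x : ℂ)) x :=
    analyticAt_const.mul (Complex.ofRealCLM.analyticAt x)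
  exact (h1.restrictScalars (𝕜 := ℝ)).comp_of_eq h2 rfl

end helpers

/-- For a nonnegative measure `μ` on `ℝ`, the following are equivalent: exponential finiteness on
an interval around `0`; finiteness of `μ` together with real-analyticity of its characteristic
function near `0`; and finiteness of its moment generating function near `0`. -/
theorem stmt11 (μ : Measure ℝ) :
    ((∃ ε : ℝ, 0 < ε ∧ ∀ y ∈ Set.Ioo (-ε) ε, Integrable (fun t : ℝ => Real.exp (-y * t)) μ) ↔
      (IsFiniteMeasure μ ∧
        ∃ U : Set ℝ, IsOpen U ∧ (0 : ℝ) ∈ U ∧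
          ∀ x ∈ U, AnalyticAt ℝ (fun x : ℝ => ∫ t : ℝ, Complex.exp (I * (x : ℂ) * t) ∂μ) x)) ∧
    ((IsFiniteMeasure μ ∧
        ∃ U : Set ℝ, IsOpen U ∧ (0 : ℝ) ∈ U ∧
          ∀ x ∈ U, AnalyticAt ℝ (fun x : ℝ => ∫ t : ℝ, Complex.exp (I * (x : ℂ) * t) ∂μ) x) ↔
      (∃ δ : ℝ, 0 < δ ∧ ∀ u ∈ Set.Ioo (-δ) δ, Integrable (fun t : ℝ => Real.exp (u * t)) μ)) := by
  have h13 : (∃ ε : ℝ, 0 < ε ∧ ∀ y ∈ Set.Ioo (-ε) ε,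
      Integrable (fun t : ℝ => Real.exp (-y * t)) μ) ↔
      (∃ δ : ℝ, 0 < δ ∧ ∀ u ∈ Set.Ioo (-δ) δ, Integrable (fun t : ℝ => Real.exp (u * t)) μ) := by
    constructor
    · rintro ⟨ε, hε, h⟩
      refine ⟨ε, hε, fun u hu => ?_⟩
      simpa using h (-u) ⟨by linarith [hu.2], by linarith [hu.1]⟩
    · rintro ⟨ε, hε, h⟩
      exact ⟨ε, hε, fun u hu => h (-u) ⟨by linarith [hu.2], by linarith [hu.1]⟩⟩
  have h23 : (IsFiniteMeasure μ ∧
        ∃ U : Set ℝ, IsOpen U ∧ (0 : ℝ) ∈ U ∧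
          ∀ x ∈ U, AnalyticAt ℝ (fun x : ℝ => ∫ t : ℝ, Complex.exp (I * (x : ℂ) * t) ∂μ) x) ↔
      (∃ δ : ℝ, 0 < δ ∧ ∀ u ∈ Set.Ioo (-δ) δ, Integrable (fun t : ℝ => Real.exp (u * t)) μ) := by
    constructor
    · rintro ⟨hfin, U, _, h0, hU⟩
      exact aux_hard μ (hU 0 h0)
    · intro h
      obtain ⟨h1, h2⟩ := aux_easy μ h
      exact ⟨h1, Set.univ, isOpen_univ, Set.mem_univ _, fun x _ => h2 x⟩
  exact ⟨h13.trans h23.symm, h23⟩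
end
end

section
/- The Riemann zeta function ζ is co-positive definite on the half-plane T_{1,+∞} = {z ∈ ℂ : Re z > 1}; on the other hand, for all real numbers a < b with b ≤ 1, ζ is neither co-positive definite nor co-negative definite on the vertical strip T_{a,b}. -/
open Complex MeasureTheory Filter Set Topology
open scoped Real BigOperators ComplexOrder

noncomputable section

/-- Real co-positive definiteness on `(A,B)`. -/
def RPD (f : ℝ → ℝ) (A B : ℝ) : Prop :=
  ∀ (n : ℕ) (x ξ : Fin n → ℝ), (∀ k, A < 2 * x k ∧ 2 * x k < B) →
    0 ≤ ∑ k, ∑ l, f (x k + x l) * ξ k * ξ l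

/-- Hankel positivity of the derivatives at `c`. -/
def HankelPos (F : ℕ → ℝ → ℝ) (c : ℝ) : Prop :=
  ∀ (N : ℕ) (d : ℕ → ℝ),
    0 ≤ ∑ m ∈ Finset.range N, ∑ n ∈ Finset.range N, F (m + n) c * d m * d n

lemma fwd_mean (h : ℝ) (hh : 0 < h) (m : ℕ) : ∀ (F : ℕ → ℝ → ℝ) (b c : ℝ),
    (∀ k, ∀ x < b, HasDerivAt (F k) (F (k + 1) x) x) → c + m * h < b →
    ∃ y ∈ Set.Icc c (c + m * h), (fwdDiff h)^[m] (F 0) c = h ^ m * F m y := by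
  induction m with
  | zero =>
    intro F b c _ _
    exact ⟨c, by simp, by simp⟩
  | succ m ih =>
    intro F b c hF hc
    push_cast at hc ⊢
    obtain ⟨y, hy, hy2⟩ := ih (fun k x => F k (x + h) - F k x) (b - h) c (by
      intro k x hx
      exact ((hF k (x + h) (by linarith)).comp_add_const x h).sub (hF k x (by linarith)))
      (by linarith)
    have hy1 := hy.1
    have hy3 := hy.2
    obtain ⟨z, hz, hz2⟩ := exists_hasDerivAt_eq_slope (F m) (F (m + 1)) (a := y) (b := y + h)
      (by linarith)
      (fun x hx => (hF m x (by linarith [hx.2])).continuousAt.continuousWithinAt)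
      (fun x hx => hF m x (by linarith [hx.2]))
    refine ⟨z, ⟨by linarith [hz.1], by linarith [hz.2]⟩, ?_⟩
    rw [Function.iterate_succ_apply]
    have : fwdDiff h (F 0) = fun x => F 0 (x + h) - F 0 x := rfl
    rw [this, hy2, hz2, add_sub_cancel_left, pow_succ, mul_assoc, mul_div_cancel₀ _ hh.ne']

lemma fwd_tendsto (F : ℕ → ℝ → ℝ) (b c : ℝ)
    (hF : ∀ k, ∀ x < b, HasDerivAt (F k) (F (k + 1) x) x) (hc : c < b) (m : ℕ) :
    Tendsto (fun h : ℝ => (h ^ m)⁻¹ * (fwdDiff h)^[m] (F 0) c) (𝓝[>] 0) (𝓝 (F m c)) := by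
  have hcont : ContinuousAt (F m) c := (hF m c hc).continuousAt
  rw [Metric.tendsto_nhds]
  intro ε hε
  obtain ⟨δ, hδ, hδ2⟩ := Metric.continuousAt_iff.1 hcont ε hε
  have ht : Tendsto (fun h : ℝ => (m : ℝ) * h) (𝓝[>] 0) (𝓝 0) := by
    have : Tendsto (fun h : ℝ => (m : ℝ) * h) (𝓝 0) (𝓝 (m * 0)) := by
      apply Continuous.tendsto; fun_prop
    rw [mul_zero] at this
    exact this.mono_left nhdsWithin_le_nhds
  have h1 := ht.eventually (gt_mem_nhds hδ)
  have h2 := ht.eventually (gt_mem_nhds (sub_pos.2 hc))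
  filter_upwards [h1, h2, self_mem_nhdsWithin] with h h1 h2 h3
  have h3 : 0 < h := h3
  obtain ⟨y, hy, hy2⟩ := fwd_mean h h3 m F b c hF (by linarith)
  rw [hy2, inv_mul_cancel_left₀ (by positivity)]
  apply hδ2
  rw [Real.dist_eq, abs_lt]
  constructor <;> linarith [hy.1, hy.2]

/-- Coefficients of iterated forward difference. -/
def fw (m i : ℕ) : ℝ := (-1 : ℝ) ^ (m - i) * m.choose i

lemma fwd_sum (f : ℝ → ℝ) (h y : ℝ) (N m : ℕ) (hm : m < N) :
    (fwdDiff h)^[m] f y = ∑ i ∈ Finset.range N, fw m i * f (y + i * h) := by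
  rw [fwdDiff_iter_eq_sum_shift]
  rw [← Finset.sum_subset (Finset.range_mono (Nat.succ_le_of_lt hm))]
  · apply Finset.sum_congr rfl
    intro i _
    simp [fw]
  · intro i _ hi
    have : m < i := by simp at hi; omega
    simp [fw, Nat.choose_eq_zero_of_lt this]

lemma fwd_sum2 (f : ℝ → ℝ) (h y : ℝ) (N m n : ℕ) (hm : m < N) (hn : n < N) :
    (fwdDiff h)^[m + n] f y = ∑ i ∈ Finset.range N, ∑ j ∈ Finset.range N,
      fw m i * fw n j * f (y + i * h + j * h) := by
  rw [Function.iterate_add_apply, fwd_sum _ h y N m hm]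
  apply Finset.sum_congr rfl
  intro i _
  rw [fwd_sum f h _ N n hn, Finset.mul_sum]
  apply Finset.sum_congr rfl
  intro j _
  ring

lemma hankel_of_rpd (F : ℕ → ℝ → ℝ) (a b c : ℝ)
    (hF : ∀ k, ∀ x < b, HasDerivAt (F k) (F (k + 1) x) x) (hac : a < c) (hc : c < b)
    (hp : RPD (F 0) a b) : HankelPos F c := by
  intro N d
  have ht : Tendsto (fun h : ℝ => ∑ m ∈ Finset.range N, ∑ n ∈ Finset.range N,
      ((h ^ (m + n))⁻¹ * (fwdDiff h)^[m + n] (F 0) c) * d m * d n) (𝓝[>] 0)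
      (𝓝 (∑ m ∈ Finset.range N, ∑ n ∈ Finset.range N, F (m + n) c * d m * d n)) := by
    apply tendsto_finsetSum
    intro m _
    apply tendsto_finsetSum
    intro n _
    exact ((fwd_tendsto F b c hF hc (m + n)).mul_const _).mul_const _
  refine ge_of_tendsto ht ?_
  have ht : Tendsto (fun h : ℝ => 2 * (N : ℝ) * h) (𝓝[>] 0) (𝓝 0) := by
    have : Tendsto (fun h : ℝ => 2 * (N : ℝ) * h) (𝓝 0) (𝓝 (2 * N * 0)) := by
      apply Continuous.tendsto; fun_prop
    rw [mul_zero] at this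
    exact this.mono_left nhdsWithin_le_nhds
  filter_upwards [ht.eventually (gt_mem_nhds (sub_pos.2 hc)), self_mem_nhdsWithin] with h h2 h3
  have h3 : 0 < h := h3
  have key := hp N (fun k => c / 2 + k * h)
    (fun k => ∑ m ∈ Finset.range N, d m * (h ^ m)⁻¹ * fw m k) (by
      intro k
      have hk : (k : ℝ) * h ≤ N * h := by
        gcongr; exact_mod_cast k.2.le
      have hk0 : 0 ≤ (k : ℝ) * h := by positivity
      constructor <;> linarith)
  rw [Finset.sum_fin_eq_sum_range] at key
  refine le_of_le_of_eq key (Eq.symm ?_)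
  have e1 : ∀ m ∈ Finset.range N, ∀ n ∈ Finset.range N,
      ((h ^ (m + n))⁻¹ * (fwdDiff h)^[m + n] (F 0) c) * d m * d n =
      ∑ i ∈ Finset.range N, ∑ j ∈ Finset.range N,
        F 0 (c / 2 + i * h + (c / 2 + j * h)) * (d m * (h ^ m)⁻¹ * fw m i) *
          (d n * (h ^ n)⁻¹ * fw n j) := by
    intro m hm n hn
    rw [fwd_sum2 (F 0) h c N m n (Finset.mem_range.1 hm) (Finset.mem_range.1 hn),
      Finset.mul_sum, Finset.sum_mul, Finset.sum_mul]
    apply Finset.sum_congr rfl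
    intro i _
    rw [Finset.mul_sum, Finset.sum_mul, Finset.sum_mul]
    apply Finset.sum_congr rfl
    intro j _
    rw [show c / 2 + i * h + (c / 2 + j * h) = c + i * h + j * h by ring, pow_add, mul_inv]
    ring
  rw [Finset.sum_congr rfl (fun m hm => Finset.sum_congr rfl (e1 m hm))]
  have e2 : ∀ i ∈ Finset.range N, (if hi : i < N then
      ∑ l : Fin N, F 0 (c / 2 + ((⟨i, hi⟩ : Fin N) : ℕ) * h + (c / 2 + (l : ℕ) * h)) *
        (∑ m ∈ Finset.range N, d m * (h ^ m)⁻¹ * fw m ((⟨i, hi⟩ : Fin N) : ℕ)) *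
        (∑ m ∈ Finset.range N, d m * (h ^ m)⁻¹ * fw m l) else 0) =
      ∑ j ∈ Finset.range N, F 0 (c / 2 + i * h + (c / 2 + j * h)) *
        (∑ m ∈ Finset.range N, d m * (h ^ m)⁻¹ * fw m i) *
        (∑ m ∈ Finset.range N, d m * (h ^ m)⁻¹ * fw m j) := by
    intro i hi
    rw [dif_pos (Finset.mem_range.1 hi)]
    exact Fin.sum_univ_eq_sum_range (fun j => F 0 (c / 2 + i * h + (c / 2 + j * h)) *
        (∑ m ∈ Finset.range N, d m * (h ^ m)⁻¹ * fw m i) *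
        (∑ m ∈ Finset.range N, d m * (h ^ m)⁻¹ * fw m j)) N
  rw [Finset.sum_congr rfl e2]
  simp only [Finset.mul_sum, Finset.sum_mul]
  -- LHS m n i j ; RHS i j n m
  calc _ = ∑ m ∈ Finset.range N, ∑ i ∈ Finset.range N, ∑ n ∈ Finset.range N,
            ∑ j ∈ Finset.range N, _ := Finset.sum_congr rfl (fun m _ => Finset.sum_comm)
    _ = ∑ i ∈ Finset.range N, ∑ m ∈ Finset.range N, ∑ n ∈ Finset.range N,
            ∑ j ∈ Finset.range N, _ := Finset.sum_comm
    _ = ∑ i ∈ Finset.range N, ∑ m ∈ Finset.range N, ∑ j ∈ Finset.range N,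
            ∑ n ∈ Finset.range N, _ :=
          Finset.sum_congr rfl (fun i _ => Finset.sum_congr rfl (fun m _ => Finset.sum_comm))
    _ = ∑ i ∈ Finset.range N, ∑ j ∈ Finset.range N, ∑ m ∈ Finset.range N,
            ∑ n ∈ Finset.range N, _ := Finset.sum_congr rfl (fun i _ => Finset.sum_comm)
    _ = _ := Finset.sum_congr rfl (fun i _ => Finset.sum_congr rfl (fun j _ => Finset.sum_comm))

lemma antidiag_sum (p q : ℝ) (G : ℕ → ℝ) (N : ℕ) :
    ∑ x ∈ Finset.HasAntidiagonal.antidiagonal N, G (x.1 + x.2) * (p ^ x.1 / x.1.factorial) *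
      (q ^ x.2 / x.2.factorial) = G N * (p + q) ^ N / N.factorial := by
  rw [(Commute.all p q).add_pow', Finset.mul_sum, Finset.sum_div]
  apply Finset.sum_congr rfl
  rintro ⟨i, j⟩ hx
  have hx : i + j = N := by simpa using hx
  subst hx
  have := Nat.add_choose_mul_factorial_mul_factorial i j
  rw [← Nat.choose_symm_add] at this
  have h2 : ((i + j).factorial : ℝ) = (i + j).choose i * i.factorial * j.factorial := by
    exact_mod_cast this.symm
  have hne : ((i + j).choose i : ℝ) ≠ 0 := by
    exact_mod_cast (Nat.choose_pos (by omega)).ne'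
  have hi : (i.factorial : ℝ) ≠ 0 := by positivity
  have hj : (j.factorial : ℝ) ≠ 0 := by positivity
  simp only [h2, nsmul_eq_mul]
  field_simp

lemma double_hasSum (G : ℕ → ℝ) (r : ℝ) (f : ℝ → ℝ)
    (hT : ∀ u, |u| < r → HasSum (fun n : ℕ => G n * u ^ n / n.factorial) (f u))
    (p q : ℝ) (hpq : |p| + |q| < r) :
    HasSum (fun x : ℕ × ℕ => G (x.1 + x.2) * (p ^ x.1 / x.1.factorial) *
      (q ^ x.2 / x.2.factorial)) (f (p + q)) := by
  have hs : Summable (fun x : ℕ × ℕ => |G (x.1 + x.2)| * (|p| ^ x.1 / x.1.factorial) *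
      (|q| ^ x.2 / x.2.factorial)) := by
    rw [← Finset.HasAntidiagonal.sigmaAntidiagonalEquivProd.summable_iff,
      summable_sigma_of_nonneg (by intro x; simp only [Function.comp]; positivity)]
    refine ⟨fun n => (hasSum_fintype _).summable, ?_⟩
    have := (hT (|p| + |q|) (by rwa [abs_of_nonneg (by positivity)])).summable.abs
    refine this.congr (fun N => ?_)
    rw [tsum_fintype]
    have h2 := antidiag_sum (|p|) (|q|) (fun n => |G n|) N
    rw [← Finset.sum_coe_sort] at h2
    simp only [Function.comp, Finset.HasAntidiagonal.sigmaAntidiagonalEquivProd_apply]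
    rw [h2, abs_div, abs_mul, abs_pow, abs_of_nonneg (show 0 ≤ |p| + |q| by positivity),
      Nat.abs_cast]
  have hs2 : Summable (fun x : ℕ × ℕ => G (x.1 + x.2) * (p ^ x.1 / x.1.factorial) *
      (q ^ x.2 / x.2.factorial)) := by
    apply Summable.of_norm
    convert hs using 2 with x
    simp [abs_mul, abs_div, abs_pow]
  obtain ⟨v, hv⟩ := hs2
  have hv' := hv
  rw [← Finset.HasAntidiagonal.sigmaAntidiagonalEquivProd.hasSum_iff] at hv
  have h3 := hv.sigma (fun n => hasSum_fintype _)
  have h4 : HasSum (fun N : ℕ => G N * (p + q) ^ N / N.factorial) v := by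
    convert h3 using 2 with N
    have h2 := antidiag_sum p q G N
    rw [← Finset.sum_coe_sort] at h2
    exact h2.symm
  rwa [(hT (p + q) ((abs_add_le p q).trans_lt hpq)).unique h4]

lemma rpd_of_hankel (F : ℕ → ℝ → ℝ) (c : ℝ)
    (hT : ∀ u, |u| < 1 - c → HasSum (fun n : ℕ => F n c * u ^ n / n.factorial) (F 0 (c + u)))
    (hH : HankelPos F c) : RPD (F 0) (2 * c - 1) 1 := by
  intro n x ξ hx
  have hab : ∀ k, |x k - c / 2| < (1 - c) / 2 := by
    intro k
    rw [abs_lt]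
    constructor <;> linarith [(hx k).1, (hx k).2]
  have hr : Tendsto (fun N : ℕ => Finset.range N ×ˢ Finset.range N) atTop atTop := by
    apply tendsto_atTop_finset_of_monotone
    · intro a b hab
      exact Finset.product_subset_product (Finset.range_mono hab) (Finset.range_mono hab)
    · intro y
      refine ⟨y.1 + y.2 + 1, ?_⟩
      simp only [Finset.mem_product, Finset.mem_range]
      omega
  have hs : ∀ k l, Tendsto (fun N : ℕ => ∑ i ∈ Finset.range N, ∑ j ∈ Finset.range N,
      F (i + j) c * ((x k - c / 2) ^ i / i.factorial) * ((x l - c / 2) ^ j / j.factorial))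
      atTop (𝓝 (F 0 (x k + x l))) := by
    intro k l
    have h1 := double_hasSum (fun n => F n c) (1 - c) (fun u => F 0 (c + u)) hT
      (x k - c / 2) (x l - c / 2) (by linarith [hab k, hab l])
    have h2 := Tendsto.comp h1 hr
    rw [show c + (x k - c / 2 + (x l - c / 2)) = x k + x l by ring] at h2
    refine h2.congr ?_
    intro N
    simp only [Function.comp]
    rw [Finset.sum_product]
  have ht := tendsto_finsetSum (Finset.univ : Finset (Fin n)) (fun k _ =>
    tendsto_finsetSum (Finset.univ : Finset (Fin n)) (fun l _ =>
      ((hs k l).mul_const (ξ k)).mul_const (ξ l)))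
  refine ge_of_tendsto ht (Eventually.of_forall ?_)
  intro N
  have key := hH N (fun m => ∑ k, ξ k * ((x k - c / 2) ^ m / m.factorial))
  refine le_of_le_of_eq key (Eq.symm ?_)
  simp only [Finset.mul_sum, Finset.sum_mul]
  -- LHS k l i j ; RHS i j l k
  calc _ = ∑ k, ∑ i ∈ Finset.range N, ∑ l, ∑ j ∈ Finset.range N, _ :=
          Finset.sum_congr rfl (fun m _ => Finset.sum_comm)
    _ = ∑ i ∈ Finset.range N, ∑ k, ∑ l, ∑ j ∈ Finset.range N, _ := Finset.sum_comm
    _ = ∑ i ∈ Finset.range N, ∑ k, ∑ j ∈ Finset.range N, ∑ l, _ :=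
          Finset.sum_congr rfl (fun i _ => Finset.sum_congr rfl (fun m _ => Finset.sum_comm))
    _ = ∑ i ∈ Finset.range N, ∑ j ∈ Finset.range N, ∑ k, ∑ l, _ :=
          Finset.sum_congr rfl (fun i _ => Finset.sum_comm)
    _ = ∑ i ∈ Finset.range N, ∑ j ∈ Finset.range N, ∑ l, ∑ k, _ :=
          Finset.sum_congr rfl (fun i _ => Finset.sum_congr rfl (fun j _ => Finset.sum_comm))
    _ = _ := by
          refine Finset.sum_congr rfl (fun i _ => Finset.sum_congr rfl (fun j _ =>
            Finset.sum_congr rfl (fun l _ => Finset.sum_congr rfl (fun k _ => ?_))))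
          ring

/-- Real derivatives of `ε ζ`. -/
def ZF (ε : ℝ) (n : ℕ) (x : ℝ) : ℝ := ε * (iteratedDeriv n riemannZeta (x : ℂ)).re

lemma zeta_analytic (x : ℝ) (hx : x < 1) : AnalyticAt ℂ riemannZeta (x : ℂ) := by
  have : DifferentiableOn ℂ riemannZeta {1}ᶜ := fun s hs =>
    (differentiableAt_riemannZeta hs).differentiableWithinAt
  apply this.analyticAt
  apply isOpen_compl_singleton.mem_nhds
  simp only [mem_compl_iff, mem_singleton_iff]
  exact_mod_cast hx.ne

lemma ZF_deriv (ε : ℝ) (k : ℕ) (x : ℝ) (hx : x < 1) :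
    HasDerivAt (ZF ε k) (ZF ε (k + 1) x) x := by
  have h := ((zeta_analytic x hx).iterated_deriv k).differentiableAt.hasDerivAt
  rw [← iteratedDeriv_eq_iterate, ← iteratedDeriv_succ] at h
  exact (h.real_of_complex).const_mul ε

lemma ZF_taylor (ε c : ℝ) (u : ℝ) (hu : |u| < 1 - c) :
    HasSum (fun n : ℕ => ZF ε n c * u ^ n / n.factorial) (ZF ε 0 (c + u)) := by
  have hd : DifferentiableOn ℂ riemannZeta (Metric.ball (c : ℂ) (1 - c)) := by
    intro s hs
    refine (differentiableAt_riemannZeta ?_).differentiableWithinAt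
    rintro rfl
    have h1 : dist (1 : ℂ) c < 1 - c := hs
    rw [dist_eq_norm, ← Complex.ofReal_one, ← Complex.ofReal_sub, Complex.norm_real,
      Real.norm_eq_abs] at h1
    exact absurd h1 (not_lt.2 (le_abs_self _))
  have h := Complex.hasSum_taylorSeries_on_ball hd (z := ((c + u : ℝ) : ℂ)) (by
    rw [Metric.mem_ball, dist_eq_norm, ← Complex.ofReal_sub, Complex.norm_real,
      Real.norm_eq_abs]
    simpa using hu)
  have h2 := (Complex.hasSum_re h).mul_left ε
  have h3 : ZF ε 0 (c + u) = ε * (riemannZeta ((c + u : ℝ) : ℂ)).re := by simp [ZF]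
  rw [h3]
  refine (congrArg (fun g => HasSum g (ε * (riemannZeta ((c + u : ℝ) : ℂ)).re)) (funext fun n => ?_)).mpr h2
  have : ((n.factorial : ℂ)⁻¹ • (((c + u : ℝ) : ℂ) - c) ^ n • iteratedDeriv n riemannZeta c) =
      (((n.factorial : ℝ)⁻¹ * u ^ n : ℝ) : ℂ) * iteratedDeriv n riemannZeta c := by
    push_cast
    simp [smul_eq_mul, mul_assoc]
  rw [this, Complex.re_ofReal_mul, ZF]
  ring

lemma no_rpd (ε : ℝ) (hε : ε = 1 ∨ ε = -1) (a b : ℝ) (hab : a < b) (hb : b ≤ 1) :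
    ¬ RPD (ZF ε 0) a b := by
  intro hp
  obtain ⟨c, hac, hcb⟩ := exists_between hab
  have h0 : HankelPos (ZF ε) c :=
    hankel_of_rpd _ a b c (fun k x hx => ZF_deriv ε k x (by linarith)) hac hcb hp
  have hc : 0 < 1 - c := by linarith
  have hn : ∀ n : ℕ, HankelPos (ZF ε) (1 - (3 / 2) ^ n * (1 - c)) := by
    intro n
    induction n with
    | zero => simpa using h0
    | succ n ih =>
      have h1 := rpd_of_hankel _ _ (fun u hu => ZF_taylor ε _ u hu) ih
      have hpos : 0 < (3 / 2 : ℝ) ^ n * (1 - c) := by positivity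
      refine hankel_of_rpd _ _ 1 _ (fun k x hx => ZF_deriv ε k x hx) ?_ ?_ h1
      · rw [pow_succ]; linarith
      · rw [pow_succ]; linarith
  obtain ⟨n, hn2⟩ := pow_unbounded_of_one_lt ((3 / 2) / (1 - c)) (show (1 : ℝ) < 3 / 2 by norm_num)
  rw [div_lt_iff₀ hc] at hn2
  have h1 := rpd_of_hankel _ _ (fun u hu => ZF_taylor ε _ u hu) (hn n)
  generalize (3 / 2 : ℝ) ^ n * (1 - c) = X at h1 hn2
  have z0 : ZF ε 0 0 = ε * (-1 / 2) := by
    simp [ZF, riemannZeta_zero]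
  have z1 : ZF ε 0 (-1) = ε * (-1 / 12) := by
    have := riemannZeta_neg_nat_eq_bernoulli 1
    norm_num [bernoulli, bernoulli'_two] at this
    simp [ZF, this]
    norm_num
  have z2 : ZF ε 0 (-2) = 0 := by
    have := riemannZeta_neg_two_mul_nat_add_one 0
    norm_num at this
    simp [ZF, this]
  have key : ∀ t : ℝ, 0 ≤ ε * (-1 / 12) * t * 2 + ε * (-1 / 2) := by
    intro t
    have := h1 2 ![-1, 0] ![t, 1] (by
      intro k
      fin_cases k <;> constructor <;> norm_num <;> linarith)
    simp only [Fin.sum_univ_two, Matrix.cons_val_zero, Matrix.cons_val_one] at this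
    norm_num [z0, z1, z2] at this
    linarith
  have k1 := key 12
  have k2 := key (-12)
  rcases hε with rfl | rfl <;> linarith

lemma rpd_of_co (ε : ℝ) (f : ℂ → ℂ) (hf : ∀ z, f z = ε * riemannZeta z) (a b : ℝ)
    (h : IsCoPosDefOnC f (VStrip (a : EReal) (b : EReal))) : RPD (ZF ε 0) a b := by
  intro n x ξ hx
  have := h n (fun k => (x k : ℂ)) (by
    intro k l
    simp only [VStrip, Set.mem_ofPred_eq, Complex.conj_ofReal, Complex.add_re, Complex.ofReal_re,
      EReal.coe_lt_coe_iff]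
    constructor <;> linarith [(hx k).1, (hx k).2, (hx l).1, (hx l).2]) (fun k => (ξ k : ℂ))
  have h2 := (Complex.le_def.1 this).1
  simp only [Complex.zero_re, Complex.re_sum, Complex.conj_ofReal] at h2
  convert h2 using 4 with k _ l _
  rw [Complex.re_mul_ofReal, Complex.re_mul_ofReal, hf, Complex.re_ofReal_mul]
  simp [ZF]

lemma zeta_co : IsCoPosDefOnC riemannZeta (VStrip 1 ⊤) := by
  intro n z hz ξ
  have hre : ∀ k l, 1 < (z k + (starRingEnd ℂ) (z l)).re := by
    intro k l
    have := (hz k l).1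
    exact_mod_cast this
  have hs : ∀ k l, HasSum (fun m : ℕ => 1 / ((m : ℂ) + 1) ^ (z k + (starRingEnd ℂ) (z l)))
      (riemannZeta (z k + (starRingEnd ℂ) (z l))) := by
    intro k l
    rw [zeta_eq_tsum_one_div_nat_add_one_cpow (hre k l)]
    apply Summable.hasSum
    have := (summable_nat_add_iff 1).2 (Complex.summable_one_div_nat_cpow.2 (hre k l))
    simpa using this
  have ht := hasSum_sum (s := (Finset.univ : Finset (Fin n))) (fun k _ =>
    hasSum_sum (s := (Finset.univ : Finset (Fin n))) (fun l _ =>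
      ((hs k l).mul_right (ξ k)).mul_right ((starRingEnd ℂ) (ξ l))))
  refine ht.nonneg ?_
  intro m
  have e : ∑ k, ∑ l, 1 / ((m : ℂ) + 1) ^ (z k + (starRingEnd ℂ) (z l)) * ξ k *
      (starRingEnd ℂ) (ξ l) = (∑ k, ξ k / ((m : ℂ) + 1) ^ (z k)) *
        (starRingEnd ℂ) (∑ k, ξ k / ((m : ℂ) + 1) ^ (z k)) := by
    rw [map_sum, Finset.sum_mul_sum]
    refine Finset.sum_congr rfl (fun k _ => Finset.sum_congr rfl (fun l _ => ?_))
    have hm : ((m : ℂ) + 1) ≠ 0 := by exact_mod_cast Nat.succ_ne_zero m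
    have harg : ((m : ℂ) + 1).arg ≠ Real.pi := by
      rw [show ((m : ℂ) + 1) = (((m : ℝ) + 1 : ℝ) : ℂ) by push_cast; rfl,
        Complex.arg_ofReal_of_nonneg (by positivity)]
      exact Real.pi_pos.ne
    have hc : (starRingEnd ℂ) (((m : ℂ) + 1) ^ (z l)) = ((m : ℂ) + 1) ^ (starRingEnd ℂ) (z l) := by
      rw [Complex.cpow_conj _ _ harg]
      simp
    rw [map_div₀, hc, Complex.cpow_add _ _ hm]
    field_simp
  rw [e, Complex.mul_conj]
  exact_mod_cast Complex.normSq_nonneg _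

/-- The Riemann zeta function is co-positive definite on the half-plane `Re z > 1`, but is
neither co-positive nor co-negative definite on any vertical strip `T_{a,b}` with `b ≤ 1`. -/
theorem stmt16 :
    IsCoPosDefOnC riemannZeta (VStrip 1 ⊤) ∧
    ∀ a b : ℝ, a < b → b ≤ 1 →
      ¬ IsCoPosDefOnC riemannZeta (VStrip (a : EReal) (b : EReal)) ∧
      ¬ IsCoPosDefOnC (fun z => -riemannZeta z) (VStrip (a : EReal) (b : EReal)) := by
  refine ⟨zeta_co, fun a b hab hb => ⟨fun h => ?_, fun h => ?_⟩⟩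
  · exact no_rpd 1 (Or.inl rfl) a b hab hb (rpd_of_co 1 _ (fun z => by simp) a b h)
  · exact no_rpd (-1) (Or.inr rfl) a b hab hb (rpd_of_co (-1) _ (fun z => by simp) a b h)
end
end
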